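/- arXiv:2506.21065 — 7 statements merged into one kernel-verified Lean document; each statement's English description precedes it below -/
import Mathlib

section
/- Let Ω = (0,L_x)×(0,L_y) with L_x, L_y > 0 and 𝒯 > 0. Suppose ρ, u, v are C¹ functions on cl(Ω)×[0,𝒯] with ρ > 0 satisfying the continuity equation ∂_t ρ + ∂_x(ρu) + ∂_y(ρv) = 0, and suppose ρ_b, c_b and v_b·n are functions on ∂Ω×[0,𝒯] with 0 < ρ_b ≤ M, 0 < c_b ≤ M and |u_b n¹ + v_b n²| ≤ M. Assume that at every boundary point and time: if v_n < 0 and |v_n| ≤ c_b then the normal mass flux satisfies ρ v_n = ρ_b v_n; if v_n < 0 and |v_n| > c_b then ρ v_n = ρ_b (u_b n¹ + v_b n²). Then for all t ∈ [0,𝒯]: ∫_Ω ρ(·,t) dx dy ≤ ∫_Ω ρ(·,0) dx dy + |∂Ω| M² t, and moreover the time-integrated outflow of mass is bounded: ∫_0^𝒯 ∫_{∂Ω} max(v_n, 0) ρ ds dt ≤ ∫_Ω ρ(·,0) dx dy + |∂Ω| M² 𝒯, where |∂Ω| = 2(L_x + L_y). -/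
open MeasureTheory Set

/-- `rectBdry Lx Ly x y n1 n2` : `(x,y)` lies on the boundary of the rectangle
`[0,Lx] × [0,Ly]` and `(n1,n2)` is a corresponding outward unit normal. -/
def rectBdry (Lx Ly x y n1 n2 : ℝ) : Prop :=
  (x = 0 ∧ y ∈ Icc 0 Ly ∧ n1 = -1 ∧ n2 = 0) ∨
  (x = Lx ∧ y ∈ Icc 0 Ly ∧ n1 = 1 ∧ n2 = 0) ∨
  (y = 0 ∧ x ∈ Icc 0 Lx ∧ n1 = 0 ∧ n2 = -1) ∨
  (y = Ly ∧ x ∈ Icc 0 Lx ∧ n1 = 0 ∧ n2 = 1)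

/-- A `C¹` function of three real variables has jointly continuous partial derivatives. -/
lemma exists_continuous_partialDeriv {f : ℝ → ℝ → ℝ → ℝ}
    (hf : ContDiff ℝ 1 (fun q : ℝ × ℝ × ℝ => f q.1 q.2.1 q.2.2)) :
    ∃ fx fy ft : ℝ → ℝ → ℝ → ℝ,
      Continuous (fun q : ℝ × ℝ × ℝ => fx q.1 q.2.1 q.2.2) ∧
      Continuous (fun q : ℝ × ℝ × ℝ => fy q.1 q.2.1 q.2.2) ∧
      Continuous (fun q : ℝ × ℝ × ℝ => ft q.1 q.2.1 q.2.2) ∧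
      ∀ x y t, HasDerivAt (fun a => f a y t) (fx x y t) x ∧
        HasDerivAt (fun b => f x b t) (fy x y t) y ∧
        HasDerivAt (fun s => f x y s) (ft x y t) t := by
  set F : ℝ × ℝ × ℝ → ℝ := fun q => f q.1 q.2.1 q.2.2 with hF
  have hcont (e : ℝ × ℝ × ℝ) : Continuous fun q => fderiv ℝ F q e :=
    (hf.continuous_fderiv one_ne_zero).clm_apply continuous_const
  have hd (q : ℝ × ℝ × ℝ) : HasFDerivAt F (fderiv ℝ F q) q :=
    (hf.differentiable one_ne_zero q).hasFDerivAt
  refine ⟨fun x y t => fderiv ℝ F (x, y, t) (1, 0, 0), fun x y t => fderiv ℝ F (x, y, t) (0, 1, 0),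
    fun x y t => fderiv ℝ F (x, y, t) (0, 0, 1), hcont _, hcont _, hcont _, fun x y t => ⟨?_, ?_, ?_⟩⟩
  · exact (hd (x, y, t)).comp_hasDerivAt x
      ((hasDerivAt_id x).prodMk ((hasDerivAt_const x y).prodMk (hasDerivAt_const x t)))
  · exact (hd (x, y, t)).comp_hasDerivAt y
      ((hasDerivAt_const y x).prodMk ((hasDerivAt_id y).prodMk (hasDerivAt_const y t)))
  · exact (hd (x, y, t)).comp_hasDerivAt t
      ((hasDerivAt_const t x).prodMk ((hasDerivAt_const t y).prodMk (hasDerivAt_id t)))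

lemma intervalIntegral_swap_of_continuous {F : ℝ → ℝ → ℝ}
    (hF : Continuous (fun p : ℝ × ℝ => F p.1 p.2)) (a b c d : ℝ) :
    ∫ x in a..b, ∫ y in c..d, F x y = ∫ y in c..d, ∫ x in a..b, F x y := by
  refine intervalIntegral_intervalIntegral_swap ?_
  have hK : IsCompact (uIcc a b ×ˢ uIcc c d) := isCompact_uIcc.prod isCompact_uIcc
  exact (ContinuousOn.integrableOn_compact hK hF.continuousOn).mono_set
    (prod_mono uIoc_subset_uIcc uIoc_subset_uIcc)

lemma setIntegral_Ioo_prod_eq_intervalIntegral {F : ℝ → ℝ → ℝ}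
    (hF : Continuous (fun p : ℝ × ℝ => F p.1 p.2)) {a b : ℝ} (ha : 0 ≤ a) (hb : 0 ≤ b) :
    ∫ q in Ioo (0 : ℝ) a ×ˢ Ioo (0 : ℝ) b, F q.1 q.2 = ∫ x in (0 : ℝ)..a, ∫ y in (0 : ℝ)..b, F x y := by
  have hK : IsCompact (Icc (0 : ℝ) a ×ˢ Icc (0 : ℝ) b) := isCompact_Icc.prod isCompact_Icc
  have hint : IntegrableOn (fun p : ℝ × ℝ => F p.1 p.2) (Ioo (0 : ℝ) a ×ˢ Ioo (0 : ℝ) b)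
      (volume.prod volume) :=
    (ContinuousOn.integrableOn_compact (μ := volume) hK hF.continuousOn).mono_set
      (prod_mono Ioo_subset_Icc_self Ioo_subset_Icc_self)
  rw [Measure.volume_eq_prod, setIntegral_prod _ hint, intervalIntegral.integral_of_le ha,
    integral_Ioc_eq_integral_Ioo]
  simp only [intervalIntegral.integral_of_le hb, integral_Ioc_eq_integral_Ioo]

/-- Integral form on a rectangle of the conservation law `∂ₜ R + ∂ₓ P + ∂ᵧ Q = 0`. -/
lemma mass_balance {R P Q : ℝ → ℝ → ℝ → ℝ}
    (hR : ContDiff ℝ 1 (fun q : ℝ × ℝ × ℝ => R q.1 q.2.1 q.2.2))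
    (hP : ContDiff ℝ 1 (fun q : ℝ × ℝ × ℝ => P q.1 q.2.1 q.2.2))
    (hQ : ContDiff ℝ 1 (fun q : ℝ × ℝ × ℝ => Q q.1 q.2.1 q.2.2))
    {a b t : ℝ} (ha : 0 ≤ a) (hb : 0 ≤ b) (ht : 0 ≤ t)
    (h : ∀ x ∈ Icc 0 a, ∀ y ∈ Icc 0 b, ∀ s ∈ Icc 0 t,
      deriv (fun s => R x y s) s + deriv (fun x => P x y s) x + deriv (fun y => Q x y s) y = 0) :
    (∫ x in (0 : ℝ)..a, ∫ y in (0 : ℝ)..b, R x y t) = (∫ x in (0 : ℝ)..a, ∫ y in (0 : ℝ)..b, R x y 0)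
      - ∫ s in (0 : ℝ)..t, ((∫ y in (0 : ℝ)..b, P a y s) - (∫ y in (0 : ℝ)..b, P 0 y s)
          + (∫ x in (0 : ℝ)..a, Q x b s) - (∫ x in (0 : ℝ)..a, Q x 0 s)) := by
  obtain ⟨_, _, Rt, _, _, hRt, hRd⟩ := exists_continuous_partialDeriv hR
  obtain ⟨Px, _, _, hPx, _, _, hPd⟩ := exists_continuous_partialDeriv hP
  obtain ⟨_, Qy, _, _, hQy, _, hQd⟩ := exists_continuous_partialDeriv hQ
  have comp3 {f : ℝ → ℝ → ℝ → ℝ} (hf : Continuous (fun q : ℝ × ℝ × ℝ => f q.1 q.2.1 q.2.2))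
      {X : Type} [TopologicalSpace X] {g₁ g₂ g₃ : X → ℝ} (h₁ : Continuous g₁)
      (h₂ : Continuous g₂) (h₃ : Continuous g₃) : Continuous fun z => f (g₁ z) (g₂ z) (g₃ z) :=
    hf.comp (h₁.prodMk (h₂.prodMk h₃))
  have cR := hR.continuous
  have cP := hP.continuous
  have cQ := hQ.continuous
  have space (s : ℝ) (hs : s ∈ Icc 0 t) : ∫ x in (0 : ℝ)..a, ∫ y in (0 : ℝ)..b, Rt x y s =
      -((∫ y in (0 : ℝ)..b, P a y s) - (∫ y in (0 : ℝ)..b, P 0 y s)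
          + (∫ x in (0 : ℝ)..a, Q x b s) - (∫ x in (0 : ℝ)..a, Q x 0 s)) := by
    have e1 : ∫ x in (0 : ℝ)..a, ∫ y in (0 : ℝ)..b, Rt x y s
        = ∫ x in (0 : ℝ)..a, ((∫ y in (0 : ℝ)..b, -Px x y s) - ∫ y in (0 : ℝ)..b, Qy x y s) := by
      refine intervalIntegral.integral_congr fun x hx => ?_
      rw [uIcc_of_le ha] at hx
      rw [← intervalIntegral.integral_sub (f := fun y => -Px x y s)
        ((comp3 hPx continuous_const continuous_id' continuous_const).neg.intervalIntegrable _ _)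
        ((comp3 hQy continuous_const continuous_id' continuous_const).intervalIntegrable _ _)]
      refine intervalIntegral.integral_congr fun y hy => ?_
      rw [uIcc_of_le hb] at hy
      have := h x hx y hy s hs
      rw [(hRd x y s).2.2.deriv, (hPd x y s).1.deriv, (hQd x y s).2.1.deriv] at this
      linarith
    have c1 : Continuous fun p : ℝ × ℝ => -Px p.1 p.2 s :=
      (comp3 hPx continuous_fst continuous_snd continuous_const).neg
    have c2 : Continuous fun p : ℝ × ℝ => Qy p.1 p.2 s :=
      comp3 hQy continuous_fst continuous_snd continuous_const
    rw [e1, intervalIntegral.integral_sub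
      ((intervalIntegral.continuous_parametric_intervalIntegral_of_continuous'
        (f := fun x y => -Px x y s) c1 _ _).intervalIntegrable _ _)
      ((intervalIntegral.continuous_parametric_intervalIntegral_of_continuous'
        (f := fun x y => Qy x y s) c2 _ _).intervalIntegrable _ _),
      intervalIntegral_swap_of_continuous c1]
    have e2 (y : ℝ) : ∫ x in (0 : ℝ)..a, -Px x y s = P 0 y s - P a y s := by
      rw [intervalIntegral.integral_neg, intervalIntegral.integral_eq_sub_of_hasDerivAt
        (fun x _ => (hPd x y s).1)
        ((comp3 hPx continuous_id' continuous_const continuous_const).intervalIntegrable _ _)]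
      ring
    have e3 (x : ℝ) : ∫ y in (0 : ℝ)..b, Qy x y s = Q x b s - Q x 0 s :=
      intervalIntegral.integral_eq_sub_of_hasDerivAt (fun y _ => (hQd x y s).2.1)
        ((comp3 hQy continuous_const continuous_id' continuous_const).intervalIntegrable _ _)
    simp only [e2, e3]
    rw [intervalIntegral.integral_sub
      ((comp3 cP continuous_const continuous_id' continuous_const).intervalIntegrable _ _)
      ((comp3 cP continuous_const continuous_id' continuous_const).intervalIntegrable _ _),
      intervalIntegral.integral_sub
      ((comp3 cQ continuous_id' continuous_const continuous_const).intervalIntegrable _ _)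
      ((comp3 cQ continuous_id' continuous_const continuous_const).intervalIntegrable _ _)]
    ring
  have cR2 (s : ℝ) : Continuous fun p : ℝ × ℝ => R p.1 p.2 s :=
    comp3 cR continuous_fst continuous_snd continuous_const
  have cRint (s : ℝ) : IntervalIntegrable (fun x => ∫ y in (0 : ℝ)..b, R x y s) volume 0 a :=
    (intervalIntegral.continuous_parametric_intervalIntegral_of_continuous'
      (f := fun x y => R x y s) (cR2 s) _ _).intervalIntegrable _ _
  have cRtx : Continuous fun p : ℝ × ℝ => ∫ y in (0 : ℝ)..b, Rt p.1 y p.2 :=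
    intervalIntegral.continuous_parametric_intervalIntegral_of_continuous'
      (f := fun (p : ℝ × ℝ) y => Rt p.1 y p.2)
      (comp3 hRt (by fun_prop) (by fun_prop) (by fun_prop)) _ _
  have time : (∫ x in (0 : ℝ)..a, ∫ y in (0 : ℝ)..b, R x y t) - (∫ x in (0 : ℝ)..a, ∫ y in (0 : ℝ)..b, R x y 0)
      = ∫ s in (0 : ℝ)..t, ∫ x in (0 : ℝ)..a, ∫ y in (0 : ℝ)..b, Rt x y s := by
    rw [← intervalIntegral_swap_of_continuous (F := fun x s => ∫ y in (0 : ℝ)..b, Rt x y s) cRtx,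
      ← intervalIntegral.integral_sub (cRint t) (cRint 0)]
    refine intervalIntegral.integral_congr fun x _ => ?_
    rw [← intervalIntegral_swap_of_continuous (F := fun y s => Rt x y s)
        (comp3 hRt continuous_const continuous_fst continuous_snd),
      ← intervalIntegral.integral_sub
        ((comp3 cR continuous_const continuous_id' continuous_const).intervalIntegrable _ _)
        ((comp3 cR continuous_const continuous_id' continuous_const).intervalIntegrable _ _)]
    refine intervalIntegral.integral_congr fun y _ => ?_
    exact (intervalIntegral.integral_eq_sub_of_hasDerivAt (fun s _ => (hRd x y s).2.2)
      ((comp3 hRt continuous_const continuous_const continuous_id').intervalIntegrable _ _)).symm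
  have time' : ∫ s in (0 : ℝ)..t, ∫ x in (0 : ℝ)..a, ∫ y in (0 : ℝ)..b, Rt x y s =
      ∫ s in (0 : ℝ)..t, -((∫ y in (0 : ℝ)..b, P a y s) - (∫ y in (0 : ℝ)..b, P 0 y s)
          + (∫ x in (0 : ℝ)..a, Q x b s) - (∫ x in (0 : ℝ)..a, Q x 0 s)) :=
    intervalIntegral.integral_congr fun s hs => space s (by rwa [uIcc_of_le ht] at hs)
  rw [intervalIntegral.integral_neg] at time'
  linarith

/-- Where the inflow mass flux is prescribed by bounded data, the normal mass flux is at least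
the outflow part minus `M ^ 2`. -/
lemma outflow_sub_sq_le_flux {r w rb c vb M : ℝ}
    (hrb : 0 < rb ∧ rb ≤ M) (hc : 0 < c ∧ c ≤ M) (hvb : |vb| ≤ M)
    (hsub : w < 0 ∧ |w| ≤ c → r * w = rb * w)
    (hsuper : w < 0 ∧ c < |w| → r * w = rb * vb) :
    max w 0 * r - M ^ 2 ≤ w * r := by
  have key (z : ℝ) (hz : |z| ≤ M) : -M ^ 2 ≤ rb * z := by
    have h1 := neg_le_of_abs_le hz
    nlinarith
  rcases le_or_gt 0 w with hw | hw
  · rw [max_eq_left hw]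
    nlinarith [sq_nonneg M]
  · rw [max_eq_right hw.le]
    rcases le_or_gt |w| c with hwc | hwc
    · have := key w (hwc.trans hc.2)
      rw [← hsub ⟨hw, hwc⟩] at this
      linarith
    · have := key vb hvb
      rw [← hsuper ⟨hw, hwc⟩] at this
      linarith

lemma integral_outflow_sub_le {w r : ℝ → ℝ} (hw : Continuous w) (hr : Continuous r) {l C : ℝ}
    (hl : 0 ≤ l) (h : ∀ z ∈ Icc 0 l, max (w z) 0 * r z - C ≤ w z * r z) :
    (∫ z in (0 : ℝ)..l, max (w z) 0 * r z) - l * C ≤ ∫ z in (0 : ℝ)..l, w z * r z := by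
  have e : (∫ z in (0 : ℝ)..l, max (w z) 0 * r z) - l * C
      = ∫ z in (0 : ℝ)..l, (max (w z) 0 * r z - C) := by
    rw [intervalIntegral.integral_sub (Continuous.intervalIntegrable (by fun_prop) _ _)
      (Continuous.intervalIntegrable (by fun_prop) _ _)]
    simp
  rw [e]
  exact intervalIntegral.integral_mono_on hl (Continuous.intervalIntegrable (by fun_prop) _ _)
    (Continuous.intervalIntegrable (by fun_prop) _ _) h

/-- a priori mass bound for a positive C¹ solution of the continuity
equation on the rectangle `Ω = (0,Lx)×(0,Ly)` with the proposed inflow boundary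
conditions: the total mass grows at most at rate `|∂Ω| M²`, and the time-integrated
mass outflow through the boundary is bounded accordingly. -/
theorem stmt_1 (Lx Ly 𝒯 M : ℝ) (hLx : 0 < Lx) (hLy : 0 < Ly) (h𝒯 : 0 < 𝒯)
    (ρ u v : ℝ → ℝ → ℝ → ℝ)
    (hρreg : ContDiff ℝ 1 (fun q : ℝ × ℝ × ℝ => ρ q.1 q.2.1 q.2.2))
    (hureg : ContDiff ℝ 1 (fun q : ℝ × ℝ × ℝ => u q.1 q.2.1 q.2.2))
    (hvreg : ContDiff ℝ 1 (fun q : ℝ × ℝ × ℝ => v q.1 q.2.1 q.2.2))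
    (hρpos : ∀ x ∈ Icc 0 Lx, ∀ y ∈ Icc 0 Ly, ∀ t ∈ Icc 0 𝒯, 0 < ρ x y t)
    (hcontinuity : ∀ x ∈ Icc 0 Lx, ∀ y ∈ Icc 0 Ly, ∀ t ∈ Icc 0 𝒯,
      deriv (fun s => ρ x y s) t + deriv (fun a => ρ a y t * u a y t) x
        + deriv (fun b => ρ x b t * v x b t) y = 0)
    (ρb cb vbn : ℝ → ℝ → ℝ → ℝ)
    (hdata : ∀ x y n1 n2, rectBdry Lx Ly x y n1 n2 → ∀ t ∈ Icc 0 𝒯,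
      (0 < ρb x y t ∧ ρb x y t ≤ M) ∧ (0 < cb x y t ∧ cb x y t ≤ M) ∧ |vbn x y t| ≤ M)
    (hbc : ∀ x y n1 n2, rectBdry Lx Ly x y n1 n2 → ∀ t ∈ Icc 0 𝒯,
      ((n1 * u x y t + n2 * v x y t < 0 ∧ |n1 * u x y t + n2 * v x y t| ≤ cb x y t) →
        ρ x y t * (n1 * u x y t + n2 * v x y t)
          = ρb x y t * (n1 * u x y t + n2 * v x y t)) ∧
      ((n1 * u x y t + n2 * v x y t < 0 ∧ cb x y t < |n1 * u x y t + n2 * v x y t|) →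
        ρ x y t * (n1 * u x y t + n2 * v x y t) = ρb x y t * vbn x y t)) :
    (∀ t ∈ Icc 0 𝒯,
      (∫ q in Ioo (0 : ℝ) Lx ×ˢ Ioo (0 : ℝ) Ly, ρ q.1 q.2 t)
        ≤ (∫ q in Ioo (0 : ℝ) Lx ×ˢ Ioo (0 : ℝ) Ly, ρ q.1 q.2 0)
          + 2 * (Lx + Ly) * M ^ 2 * t) ∧
    (∫ t in (0 : ℝ)..𝒯,
        ((∫ y in (0 : ℝ)..Ly, max (u Lx y t) 0 * ρ Lx y t)
          + (∫ y in (0 : ℝ)..Ly, max (-u 0 y t) 0 * ρ 0 y t)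
          + (∫ x in (0 : ℝ)..Lx, max (v x Ly t) 0 * ρ x Ly t)
          + (∫ x in (0 : ℝ)..Lx, max (-v x 0 t) 0 * ρ x 0 t)))
      ≤ (∫ q in Ioo (0 : ℝ) Lx ×ˢ Ioo (0 : ℝ) Ly, ρ q.1 q.2 0)
        + 2 * (Lx + Ly) * M ^ 2 * 𝒯 := by
  have comp3 {f : ℝ → ℝ → ℝ → ℝ} (hf : ContDiff ℝ 1 (fun q : ℝ × ℝ × ℝ => f q.1 q.2.1 q.2.2))
      {X : Type} [TopologicalSpace X] {g₁ g₂ g₃ : X → ℝ} (h₁ : Continuous g₁)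
      (h₂ : Continuous g₂) (h₃ : Continuous g₃) : Continuous fun z => f (g₁ z) (g₂ z) (g₃ z) :=
    hf.continuous.comp (h₁.prodMk (h₂.prodMk h₃))
  have hbdry (x y n1 n2 : ℝ) (hb : rectBdry Lx Ly x y n1 n2) (t : ℝ) (ht : t ∈ Icc 0 𝒯) :
      max (n1 * u x y t + n2 * v x y t) 0 * ρ x y t - M ^ 2
        ≤ (n1 * u x y t + n2 * v x y t) * ρ x y t := by
    obtain ⟨hrb, hc, hvb⟩ := hdata x y n1 n2 hb t ht
    obtain ⟨hsub, hsuper⟩ := hbc x y n1 n2 hb t ht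
    exact outflow_sub_sq_le_flux hrb hc hvb hsub hsuper
  set G : ℝ → ℝ := fun t => (∫ y in (0 : ℝ)..Ly, max (u Lx y t) 0 * ρ Lx y t)
          + (∫ y in (0 : ℝ)..Ly, max (-u 0 y t) 0 * ρ 0 y t)
          + (∫ x in (0 : ℝ)..Lx, max (v x Ly t) 0 * ρ x Ly t)
          + (∫ x in (0 : ℝ)..Lx, max (-v x 0 t) 0 * ρ x 0 t) with hG
  set Φ : ℝ → ℝ := fun s => (∫ y in (0 : ℝ)..Ly, ρ Lx y s * u Lx y s) - (∫ y in (0 : ℝ)..Ly, ρ 0 y s * u 0 y s)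
          + (∫ x in (0 : ℝ)..Lx, ρ x Ly s * v x Ly s) - (∫ x in (0 : ℝ)..Lx, ρ x 0 s * v x 0 s) with hΦ
  have hy {f : ℝ → ℝ → ℝ → ℝ} (hf : ContDiff ℝ 1 (fun q : ℝ × ℝ × ℝ => f q.1 q.2.1 q.2.2))
      (x : ℝ) : Continuous fun p : ℝ × ℝ => f x p.2 p.1 :=
    comp3 hf continuous_const continuous_snd continuous_fst
  have hx {f : ℝ → ℝ → ℝ → ℝ} (hf : ContDiff ℝ 1 (fun q : ℝ × ℝ × ℝ => f q.1 q.2.1 q.2.2))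
      (y : ℝ) : Continuous fun p : ℝ × ℝ => f p.2 y p.1 :=
    comp3 hf continuous_snd continuous_const continuous_fst
  have par {f : ℝ → ℝ → ℝ} (hf : Continuous fun p : ℝ × ℝ => f p.1 p.2) (l : ℝ) :
      Continuous fun s => ∫ z in (0 : ℝ)..l, f s z :=
    intervalIntegral.continuous_parametric_intervalIntegral_of_continuous' hf _ _
  have cG : Continuous G :=
    (((par (((hy hureg Lx).max continuous_const).mul (hy hρreg Lx)) Ly).add
      (par (((hy hureg 0).neg.max continuous_const).mul (hy hρreg 0)) Ly)).add
      (par (((hx hvreg Ly).max continuous_const).mul (hx hρreg Ly)) Lx)).add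
      (par (((hx hvreg 0).neg.max continuous_const).mul (hx hρreg 0)) Lx)
  have cΦ : Continuous Φ :=
    (((par ((hy hρreg Lx).mul (hy hureg Lx)) Ly).sub
      (par ((hy hρreg 0).mul (hy hureg 0)) Ly)).add
      (par ((hx hρreg Ly).mul (hx hvreg Ly)) Lx)).sub
      (par ((hx hρreg 0).mul (hx hvreg 0)) Lx)
  have hcy {f : ℝ → ℝ → ℝ → ℝ} (hf : ContDiff ℝ 1 (fun q : ℝ × ℝ × ℝ => f q.1 q.2.1 q.2.2))
      (x t : ℝ) : Continuous fun y => f x y t :=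
    comp3 hf continuous_const continuous_id continuous_const
  have hcx {f : ℝ → ℝ → ℝ → ℝ} (hf : ContDiff ℝ 1 (fun q : ℝ × ℝ × ℝ => f q.1 q.2.1 q.2.2))
      (y t : ℝ) : Continuous fun x => f x y t :=
    comp3 hf continuous_id continuous_const continuous_const
  have hGΦ (s : ℝ) (hs : s ∈ Icc 0 𝒯) : G s - 2 * (Lx + Ly) * M ^ 2 ≤ Φ s := by
    have i1 := integral_outflow_sub_le (hcy hureg Lx s) (hcy hρreg Lx s) (C := M ^ 2) hLy.le
      fun y hy => by simpa using hbdry Lx y 1 0 (.inr (.inl ⟨rfl, hy, rfl, rfl⟩)) s hs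
    have i2 := integral_outflow_sub_le (hcy hureg 0 s).neg (hcy hρreg 0 s) (C := M ^ 2) hLy.le
      fun y hy => by simpa using hbdry 0 y (-1) 0 (.inl ⟨rfl, hy, rfl, rfl⟩) s hs
    have i3 := integral_outflow_sub_le (hcx hvreg Ly s) (hcx hρreg Ly s) (C := M ^ 2) hLx.le
      fun x hx => by simpa using hbdry x Ly 0 1 (.inr (.inr (.inr ⟨rfl, hx, rfl, rfl⟩))) s hs
    have i4 := integral_outflow_sub_le (hcx hvreg 0 s).neg (hcx hρreg 0 s) (C := M ^ 2) hLx.le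
      fun x hx => by simpa using hbdry x 0 0 (-1) (.inr (.inr (.inl ⟨rfl, hx, rfl, rfl⟩))) s hs
    simp only [Pi.neg_apply, neg_mul, intervalIntegral.integral_neg] at i2 i4
    simp only [hG, hΦ, mul_comm (ρ _ _ _) (u _ _ _), mul_comm (ρ _ _ _) (v _ _ _)]
    linarith
  have hρ2 (t : ℝ) : Continuous fun p : ℝ × ℝ => ρ p.1 p.2 t :=
    comp3 hρreg continuous_fst continuous_snd continuous_const
  have main (t : ℝ) (ht : t ∈ Icc 0 𝒯) :
      (∫ q in Ioo (0 : ℝ) Lx ×ˢ Ioo (0 : ℝ) Ly, ρ q.1 q.2 t) + ∫ s in (0 : ℝ)..t, G s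
        ≤ (∫ q in Ioo (0 : ℝ) Lx ×ˢ Ioo (0 : ℝ) Ly, ρ q.1 q.2 0)
          + 2 * (Lx + Ly) * M ^ 2 * t := by
    rw [setIntegral_Ioo_prod_eq_intervalIntegral (F := fun x y => ρ x y t) (hρ2 t) hLx.le hLy.le,
      setIntegral_Ioo_prod_eq_intervalIntegral (F := fun x y => ρ x y 0) (hρ2 0) hLx.le hLy.le,
      mass_balance hρreg (P := fun x y t => ρ x y t * u x y t)
        (Q := fun x y t => ρ x y t * v x y t) (hρreg.mul hureg) (hρreg.mul hvreg)
        hLx.le hLy.le ht.1 fun x hx y hy s hs => hcontinuity x hx y hy s ⟨hs.1, hs.2.trans ht.2⟩]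
    have hmono : ∫ s in (0 : ℝ)..t, (G s - 2 * (Lx + Ly) * M ^ 2) ≤ ∫ s in (0 : ℝ)..t, Φ s :=
      intervalIntegral.integral_mono_on ht.1
        ((cG.sub continuous_const).intervalIntegrable _ _) (cΦ.intervalIntegrable _ _)
        fun s hs => hGΦ s ⟨hs.1, hs.2.trans ht.2⟩
    rw [intervalIntegral.integral_sub (cG.intervalIntegrable _ _)
      (continuous_const.intervalIntegrable _ _), intervalIntegral.integral_const, smul_eq_mul,
      sub_zero] at hmono
    simp only [hΦ] at hmono
    linarith
  refine ⟨fun t ht => ?_, ?_⟩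
  · have hG0 : 0 ≤ ∫ s in (0 : ℝ)..t, G s := by
      refine intervalIntegral.integral_nonneg ht.1 fun s hs => ?_
      have hs' : s ∈ Icc 0 𝒯 := ⟨hs.1, hs.2.trans ht.2⟩
      have x0 : (0 : ℝ) ∈ Icc 0 Lx := ⟨le_rfl, hLx.le⟩
      have x1 : Lx ∈ Icc 0 Lx := ⟨hLx.le, le_rfl⟩
      have y0 : (0 : ℝ) ∈ Icc 0 Ly := ⟨le_rfl, hLy.le⟩
      have y1 : Ly ∈ Icc 0 Ly := ⟨hLy.le, le_rfl⟩
      refine add_nonneg (add_nonneg (add_nonneg ?_ ?_) ?_) ?_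
      · exact intervalIntegral.integral_nonneg hLy.le fun y hy =>
          mul_nonneg (le_max_right _ _) (hρpos _ x1 y hy s hs').le
      · exact intervalIntegral.integral_nonneg hLy.le fun y hy =>
          mul_nonneg (le_max_right _ _) (hρpos _ x0 y hy s hs').le
      · exact intervalIntegral.integral_nonneg hLx.le fun x hx =>
          mul_nonneg (le_max_right _ _) (hρpos x hx _ y1 s hs').le
      · exact intervalIntegral.integral_nonneg hLx.le fun x hx =>
          mul_nonneg (le_max_right _ _) (hρpos x hx _ y0 s hs').le
    linarith [main t ht]
  · have hm : 0 ≤ ∫ q in Ioo (0 : ℝ) Lx ×ˢ Ioo (0 : ℝ) Ly, ρ q.1 q.2 𝒯 :=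
      setIntegral_nonneg (measurableSet_Ioo.prod measurableSet_Ioo) fun q hq =>
        (hρpos _ (Ioo_subset_Icc_self hq.1) _ (Ioo_subset_Icc_self hq.2) _ ⟨h𝒯.le, le_rfl⟩).le
    linarith [main 𝒯 ⟨h𝒯.le, le_rfl⟩]
end

section
/- Let Ω = (0,L_x)×(0,L_y) with L_x, L_y > 0. Suppose (ρ,m,n,E) is a C² admissible (ρ > 0, p > 0) classical solution of the 2-D compressible Navier–Stokes equations on cl(Ω)×[0,𝒯]. Then for every t ∈ (0,𝒯) the following entropy balance identity holds: d/dt ∫_Ω U dx dy + ∫_Ω (∂_x w · f^V + ∂_y w · g^V) dx dy = − ∮_{∂Ω} [ w · ( n¹(f^I − f^V) + n²(g^I − g^V) ) − (n¹ ψ^x + n² ψ^y) ] ds, where ∂_x w and ∂_y w denote the componentwise partial derivatives of the entropy-variable field w(ρ,m,n,E)(x,y,t), and the boundary integral is the sum of line integrals over the four sides of the rectangle with the indicated outward normals. -/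
noncomputable section

open Real MeasureTheory intervalIntegral Set

/-- A scalar field on space-time, `(x, y, t) ↦ f x y t`. -/
abbrev F3 : Type := ℝ → ℝ → ℝ → ℝ

/-- Partial derivative in `x`. -/
noncomputable def pdX (f : F3) (x y t : ℝ) : ℝ := deriv (fun a => f a y t) x
/-- Partial derivative in `y`. -/
noncomputable def pdY (f : F3) (x y t : ℝ) : ℝ := deriv (fun b => f x b t) y
/-- Partial derivative in `t`. -/
noncomputable def pdT (f : F3) (x y t : ℝ) : ℝ := deriv (fun s => f x y s) t

/-- Velocity `u = m/ρ`. -/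
noncomputable def velU (ρ m : F3) : F3 := fun x y t => m x y t / ρ x y t
/-- Velocity `v = n/ρ`. -/
noncomputable def velV (ρ n : F3) : F3 := fun x y t => n x y t / ρ x y t
/-- Pressure `p = (γ−1)(E − (m²+n²)/(2ρ))`. -/
noncomputable def press (γ : ℝ) (ρ m n E : F3) : F3 :=
  fun x y t => (γ - 1) * (E x y t - (m x y t ^ 2 + n x y t ^ 2) / (2 * ρ x y t))
/-- Temperature `T = p/(ρR)`. -/
noncomputable def temp (γ R : ℝ) (ρ m n E : F3) : F3 :=
  fun x y t => press γ ρ m n E x y t / (ρ x y t * R)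
/-- Specific entropy `S = c_v ln(p/ρ^γ)`, `c_v = R/(γ−1)`. -/
noncomputable def entS (γ R : ℝ) (ρ m n E : F3) : F3 :=
  fun x y t => (R / (γ - 1)) * Real.log (press γ ρ m n E x y t / ρ x y t ^ γ)
/-- Entropy function `U = −ρS`. -/
noncomputable def entU (γ R : ℝ) (ρ m n E : F3) : F3 :=
  fun x y t => -(ρ x y t) * entS γ R ρ m n E x y t
/-- Entropy variables `w = (−S + c_v γ − (u²+v²)/(2T), u/T, v/T, −1/T)`. -/
noncomputable def wVec (γ R : ℝ) (ρ m n E : F3) (x y t : ℝ) : Fin 4 → ℝ :=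
  ![-(entS γ R ρ m n E x y t) + (R / (γ - 1)) * γ
      - (velU ρ m x y t ^ 2 + velV ρ n x y t ^ 2) / (2 * temp γ R ρ m n E x y t),
    velU ρ m x y t / temp γ R ρ m n E x y t,
    velV ρ n x y t / temp γ R ρ m n E x y t,
    -(1 / temp γ R ρ m n E x y t)]
/-- Entropy flux potential `ψ^x = c_v(γ−1)ρu`. -/
noncomputable def psiX (γ R : ℝ) (ρ m : F3) : F3 :=
  fun x y t => (R / (γ - 1)) * (γ - 1) * (ρ x y t * velU ρ m x y t)
/-- Entropy flux potential `ψ^y = c_v(γ−1)ρv`. -/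
noncomputable def psiY (γ R : ℝ) (ρ n : F3) : F3 :=
  fun x y t => (R / (γ - 1)) * (γ - 1) * (ρ x y t * velV ρ n x y t)
/-- Inviscid flux `f^I = (ρu, ρu²+p, ρuv, u(E+p))`. -/
noncomputable def fIvec (γ : ℝ) (ρ m n E : F3) (x y t : ℝ) : Fin 4 → ℝ :=
  ![ρ x y t * velU ρ m x y t,
    ρ x y t * velU ρ m x y t ^ 2 + press γ ρ m n E x y t,
    ρ x y t * velU ρ m x y t * velV ρ n x y t,
    velU ρ m x y t * (E x y t + press γ ρ m n E x y t)]
/-- Inviscid flux `g^I = (ρv, ρuv, ρv²+p, v(E+p))`. -/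
noncomputable def gIvec (γ : ℝ) (ρ m n E : F3) (x y t : ℝ) : Fin 4 → ℝ :=
  ![ρ x y t * velV ρ n x y t,
    ρ x y t * velU ρ m x y t * velV ρ n x y t,
    ρ x y t * velV ρ n x y t ^ 2 + press γ ρ m n E x y t,
    velV ρ n x y t * (E x y t + press γ ρ m n E x y t)]
/-- Viscous stress `τxx = μ((4/3)u_x − (2/3)v_y)` (Stokes' hypothesis). -/
noncomputable def tauXX (μ : ℝ) (ρ m n : F3) : F3 :=
  fun x y t => μ * ((4 / 3) * pdX (velU ρ m) x y t - (2 / 3) * pdY (velV ρ n) x y t)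
/-- Viscous stress `τxy = μ(u_y + v_x)`. -/
noncomputable def tauXY (μ : ℝ) (ρ m n : F3) : F3 :=
  fun x y t => μ * (pdY (velU ρ m) x y t + pdX (velV ρ n) x y t)
/-- Viscous stress `τyy = μ((4/3)v_y − (2/3)u_x)`. -/
noncomputable def tauYY (μ : ℝ) (ρ m n : F3) : F3 :=
  fun x y t => μ * ((4 / 3) * pdY (velV ρ n) x y t - (2 / 3) * pdX (velU ρ m) x y t)
/-- Viscous flux `f^V = (0, τxx, τxy, uτxx + vτxy + κT_x)`. -/
noncomputable def fVvec (γ R μ κ : ℝ) (ρ m n E : F3) (x y t : ℝ) : Fin 4 → ℝ :=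
  ![0, tauXX μ ρ m n x y t, tauXY μ ρ m n x y t,
    velU ρ m x y t * tauXX μ ρ m n x y t + velV ρ n x y t * tauXY μ ρ m n x y t
      + κ * pdX (temp γ R ρ m n E) x y t]
/-- Viscous flux `g^V = (0, τxy, τyy, uτxy + vτyy + κT_y)`. -/
noncomputable def gVvec (γ R μ κ : ℝ) (ρ m n E : F3) (x y t : ℝ) : Fin 4 → ℝ :=
  ![0, tauXY μ ρ m n x y t, tauYY μ ρ m n x y t,
    velU ρ m x y t * tauXY μ ρ m n x y t + velV ρ n x y t * tauYY μ ρ m n x y t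
      + κ * pdY (temp γ R ρ m n E) x y t]
/-- The conservative variables `(ρ, m, n, E)` as a 4-vector field. -/
noncomputable def consVec (ρ m n E : F3) (x y t : ℝ) : Fin 4 → ℝ :=
  ![ρ x y t, m x y t, n x y t, E x y t]

/-- The 2-D compressible Navier–Stokes equations
`∂_t u + ∂_x f^I + ∂_y g^I = ∂_x f^V + ∂_y g^V` hold at the point `(x,y,t)`. -/
def isNSsol (γ R μ κ : ℝ) (ρ m n E : F3) (x y t : ℝ) : Prop :=
  ∀ k : Fin 4,
    pdT (fun a b s => consVec ρ m n E a b s k) x y t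
      + pdX (fun a b s => fIvec γ ρ m n E a b s k) x y t
      + pdY (fun a b s => gIvec γ ρ m n E a b s k) x y t
    = pdX (fun a b s => fVvec γ R μ κ ρ m n E a b s k) x y t
      + pdY (fun a b s => gVvec γ R μ κ ρ m n E a b s k) x y t

section Pointwise

variable {γ R : ℝ} {ρ m n E : F3} {X Y Z : ℝ → ℝ} {r' m' n' e' a : ℝ}

lemma hasDerivAt_press_curve
    (hr : HasDerivAt (fun a => ρ (X a) (Y a) (Z a)) r' a)
    (hm : HasDerivAt (fun a => m (X a) (Y a) (Z a)) m' a)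
    (hn : HasDerivAt (fun a => n (X a) (Y a) (Z a)) n' a)
    (he : HasDerivAt (fun a => E (X a) (Y a) (Z a)) e' a)
    (hρ : 0 < ρ (X a) (Y a) (Z a)) :
    HasDerivAt (fun a => press γ ρ m n E (X a) (Y a) (Z a))
      ((γ - 1) * (e' - ((m (X a) (Y a) (Z a) * m' + n (X a) (Y a) (Z a) * n')
          / ρ (X a) (Y a) (Z a)
        - (m (X a) (Y a) (Z a) ^ 2 + n (X a) (Y a) (Z a) ^ 2) * r'
          / (2 * ρ (X a) (Y a) (Z a) ^ 2)))) a := by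
  have h := (he.sub (((hm.pow 2).add (hn.pow 2)).div (hr.const_mul 2)
    (mul_pos two_pos hρ).ne')).const_mul (γ - 1)
  refine h.congr_deriv ?_
  simp only [Pi.add_apply, Pi.pow_apply]
  field_simp
  ring

lemma hasDerivAt_entS_curve {p' : ℝ}
    (hr : HasDerivAt (fun a => ρ (X a) (Y a) (Z a)) r' a)
    (hp : HasDerivAt (fun a => press γ ρ m n E (X a) (Y a) (Z a)) p' a)
    (hρ : 0 < ρ (X a) (Y a) (Z a)) (hpos : 0 < press γ ρ m n E (X a) (Y a) (Z a)) :
    HasDerivAt (fun a => entS γ R ρ m n E (X a) (Y a) (Z a))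
      (R / (γ - 1) * (p' / press γ ρ m n E (X a) (Y a) (Z a)
        - γ * r' / ρ (X a) (Y a) (Z a))) a := by
  have hrp := hr.rpow_const (p := γ) (Or.inl hρ.ne')
  have hpow : 0 < ρ (X a) (Y a) (Z a) ^ γ := rpow_pos_of_pos hρ γ
  have h := ((hp.div hrp hpow.ne').log (div_pos hpos hpow).ne').const_mul (R / (γ - 1))
  refine h.congr_deriv ?_
  rw [rpow_sub_one hρ.ne']
  simp only [Pi.div_apply]
  field_simp

lemma hasDerivAt_temp_curve {p' : ℝ} (hR : 0 < R)
    (hr : HasDerivAt (fun a => ρ (X a) (Y a) (Z a)) r' a)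
    (hp : HasDerivAt (fun a => press γ ρ m n E (X a) (Y a) (Z a)) p' a)
    (hρ : 0 < ρ (X a) (Y a) (Z a)) :
    HasDerivAt (fun a => temp γ R ρ m n E (X a) (Y a) (Z a))
      ((p' * (ρ (X a) (Y a) (Z a) * R) - press γ ρ m n E (X a) (Y a) (Z a) * (r' * R))
        / (ρ (X a) (Y a) (Z a) * R) ^ 2) a :=
  hp.div (hr.mul_const R) (mul_pos hρ hR).ne'

lemma energy_eq (hγ : 1 < γ) (x y t : ℝ) :
    E x y t = press γ ρ m n E x y t / (γ - 1)
      + (m x y t ^ 2 + n x y t ^ 2) / (2 * ρ x y t) := by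
  have : γ - 1 ≠ 0 := (sub_pos.2 hγ).ne'
  unfold press
  field_simp
  ring

/-- Derivative of the entropy function along a curve: `U' = w · (ρ, m, n, E)'`. -/
lemma hasDerivAt_entU_curve (hγ : 1 < γ)
    (hr : HasDerivAt (fun a => ρ (X a) (Y a) (Z a)) r' a)
    (hm : HasDerivAt (fun a => m (X a) (Y a) (Z a)) m' a)
    (hn : HasDerivAt (fun a => n (X a) (Y a) (Z a)) n' a)
    (he : HasDerivAt (fun a => E (X a) (Y a) (Z a)) e' a)
    (hρ : 0 < ρ (X a) (Y a) (Z a)) (hpos : 0 < press γ ρ m n E (X a) (Y a) (Z a)) :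
    HasDerivAt (fun a => entU γ R ρ m n E (X a) (Y a) (Z a))
      (∑ k, wVec γ R ρ m n E (X a) (Y a) (Z a) k * ![r', m', n', e'] k) a := by
  have hp := hasDerivAt_press_curve (γ := γ) hr hm hn he hρ
  have h := hr.neg.mul (hasDerivAt_entS_curve (R := R) hr hp hρ hpos)
  refine h.congr_deriv ?_
  have hγ' : γ - 1 ≠ 0 := (sub_pos.2 hγ).ne'
  simp only [Fin.sum_univ_four, wVec, velU, velV, temp, Pi.neg_apply, Matrix.cons_val]
  generalize entS γ R ρ m n E (X a) (Y a) (Z a) = s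
  generalize press γ ρ m n E (X a) (Y a) (Z a) = p at *
  generalize ρ (X a) (Y a) (Z a) = r at *
  generalize m (X a) (Y a) (Z a) = q₁ at *
  generalize n (X a) (Y a) (Z a) = q₂ at *
  field_simp
  ring

lemma hasDerivAt_wVec_curve {p' : ℝ} (hR : 0 < R)
    (hr : HasDerivAt (fun a => ρ (X a) (Y a) (Z a)) r' a)
    (hm : HasDerivAt (fun a => m (X a) (Y a) (Z a)) m' a)
    (hn : HasDerivAt (fun a => n (X a) (Y a) (Z a)) n' a)
    (hp : HasDerivAt (fun a => press γ ρ m n E (X a) (Y a) (Z a)) p' a)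
    (hρ : 0 < ρ (X a) (Y a) (Z a)) (hpos : 0 < press γ ρ m n E (X a) (Y a) (Z a))
    {u v u' v' T T' : ℝ}
    (hu : u = velU ρ m (X a) (Y a) (Z a)) (hv : v = velV ρ n (X a) (Y a) (Z a))
    (hT : T = temp γ R ρ m n E (X a) (Y a) (Z a))
    (hu' : u' = (m' * ρ (X a) (Y a) (Z a) - m (X a) (Y a) (Z a) * r')
      / ρ (X a) (Y a) (Z a) ^ 2)
    (hv' : v' = (n' * ρ (X a) (Y a) (Z a) - n (X a) (Y a) (Z a) * r')
      / ρ (X a) (Y a) (Z a) ^ 2)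
    (hT' : T' = (p' * (ρ (X a) (Y a) (Z a) * R)
      - press γ ρ m n E (X a) (Y a) (Z a) * (r' * R)) / (ρ (X a) (Y a) (Z a) * R) ^ 2)
    (k : Fin 4) :
    HasDerivAt (fun a => wVec γ R ρ m n E (X a) (Y a) (Z a) k)
      (![-(R / (γ - 1) * (p' / press γ ρ m n E (X a) (Y a) (Z a)
            - γ * r' / ρ (X a) (Y a) (Z a)))
          - ((u * u' + v * v') / T - (u ^ 2 + v ^ 2) * T' / (2 * T ^ 2)),
        (u' * T - u * T') / T ^ 2, (v' * T - v * T') / T ^ 2, T' / T ^ 2] k) a := by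
  have hS := hasDerivAt_entS_curve (R := R) hr hp hρ hpos
  have dT := hasDerivAt_temp_curve hR hr hp hρ
  have du : HasDerivAt (fun a => velU ρ m (X a) (Y a) (Z a)) _ a := hm.div hr hρ.ne'
  have dv : HasDerivAt (fun a => velV ρ n (X a) (Y a) (Z a)) _ a := hn.div hr hρ.ne'
  have hT0 : T ≠ 0 := by rw [hT]; exact (div_pos hpos (mul_pos hρ hR)).ne'
  rw [← hT'] at dT
  rw [← hu'] at du
  rw [← hv'] at dv
  have hT0' := hT0
  rw [hT] at hT0'
  fin_cases k
  · refine (((hS.neg.add_const (R / (γ - 1) * γ)).sub (((du.pow 2).add (dv.pow 2)).div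
      (dT.const_mul 2) (mul_ne_zero two_ne_zero hT0')))).congr_deriv ?_
    simp only [Pi.add_apply, Pi.pow_apply, ← hu, ← hv, ← hT, Fin.zero_eta, Matrix.cons_val]
    field_simp
    ring
  · refine (du.div dT hT0').congr_deriv ?_
    simp only [← hu, ← hT]
    rfl
  · refine (dv.div dT hT0').congr_deriv ?_
    simp only [← hv, ← hT]
    rfl
  · refine (((hasDerivAt_const a (1 : ℝ)).div dT hT0').neg).congr_deriv ?_
    simp only [← hT]
    simp
    ring

/-- Along any curve, `w' · f^I = (ψ^x)'`. -/
lemma sum_deriv_wVec_mul_fIvec (hγ : 1 < γ) (hR : 0 < R)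
    (hr : HasDerivAt (fun a => ρ (X a) (Y a) (Z a)) r' a)
    (hm : HasDerivAt (fun a => m (X a) (Y a) (Z a)) m' a)
    (hn : HasDerivAt (fun a => n (X a) (Y a) (Z a)) n' a)
    (he : HasDerivAt (fun a => E (X a) (Y a) (Z a)) e' a)
    (hρ : 0 < ρ (X a) (Y a) (Z a)) (hpos : 0 < press γ ρ m n E (X a) (Y a) (Z a)) :
    ∑ k, deriv (fun a => wVec γ R ρ m n E (X a) (Y a) (Z a) k) a
        * fIvec γ ρ m n E (X a) (Y a) (Z a) k
      = deriv (fun a => psiX γ R ρ m (X a) (Y a) (Z a)) a := by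
  have hp := hasDerivAt_press_curve (γ := γ) hr hm hn he hρ
  have hw := hasDerivAt_wVec_curve hR hr hm hn hp hρ hpos rfl rfl rfl rfl rfl rfl
  have hψ : HasDerivAt (fun a => psiX γ R ρ m (X a) (Y a) (Z a)) _ a :=
    (hr.mul (hm.div hr hρ.ne')).const_mul (R / (γ - 1) * (γ - 1))
  simp only [fun k => (hw k).deriv, hψ.deriv]
  have hγ' : γ - 1 ≠ 0 := (sub_pos.2 hγ).ne'
  simp only [Fin.sum_univ_four, fIvec, velU, velV, temp, Matrix.cons_val, Pi.div_apply,
    energy_eq (ρ := ρ) (m := m) (n := n) (E := E) hγ (X a) (Y a) (Z a)]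
  clear hw hψ hp
  generalize press γ ρ m n E (X a) (Y a) (Z a) = p at *
  generalize ρ (X a) (Y a) (Z a) = r at *
  generalize m (X a) (Y a) (Z a) = q₁ at *
  generalize n (X a) (Y a) (Z a) = q₂ at *
  field_simp
  ring

/-- Along any curve, `w' · g^I = (ψ^y)'`. -/
lemma sum_deriv_wVec_mul_gIvec (hγ : 1 < γ) (hR : 0 < R)
    (hr : HasDerivAt (fun a => ρ (X a) (Y a) (Z a)) r' a)
    (hm : HasDerivAt (fun a => m (X a) (Y a) (Z a)) m' a)
    (hn : HasDerivAt (fun a => n (X a) (Y a) (Z a)) n' a)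
    (he : HasDerivAt (fun a => E (X a) (Y a) (Z a)) e' a)
    (hρ : 0 < ρ (X a) (Y a) (Z a)) (hpos : 0 < press γ ρ m n E (X a) (Y a) (Z a)) :
    ∑ k, deriv (fun a => wVec γ R ρ m n E (X a) (Y a) (Z a) k) a
        * gIvec γ ρ m n E (X a) (Y a) (Z a) k
      = deriv (fun a => psiY γ R ρ n (X a) (Y a) (Z a)) a := by
  have hp := hasDerivAt_press_curve (γ := γ) hr hm hn he hρ
  have hw := hasDerivAt_wVec_curve hR hr hm hn hp hρ hpos rfl rfl rfl rfl rfl rfl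
  have hψ : HasDerivAt (fun a => psiY γ R ρ n (X a) (Y a) (Z a)) _ a :=
    (hr.mul (hn.div hr hρ.ne')).const_mul (R / (γ - 1) * (γ - 1))
  simp only [fun k => (hw k).deriv, hψ.deriv]
  have hγ' : γ - 1 ≠ 0 := (sub_pos.2 hγ).ne'
  simp only [Fin.sum_univ_four, gIvec, velU, velV, temp, Matrix.cons_val, Pi.div_apply,
    energy_eq (ρ := ρ) (m := m) (n := n) (E := E) hγ (X a) (Y a) (Z a)]
  clear hw hψ hp
  generalize press γ ρ m n E (X a) (Y a) (Z a) = p at *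
  generalize ρ (X a) (Y a) (Z a) = r at *
  generalize m (X a) (Y a) (Z a) = q₁ at *
  generalize n (X a) (Y a) (Z a) = q₂ at *
  field_simp
  ring

end Pointwise

/-- A space-time field as a function on the product `ℝ × ℝ × ℝ`. -/
def unc (f : F3) (q : ℝ × ℝ × ℝ) : ℝ := f q.1 q.2.1 q.2.2

section PartialDerivatives

variable {f : F3} {x y t : ℝ}

lemma hasDerivAt_fst_fderiv (h : DifferentiableAt ℝ (unc f) (x, y, t)) :
    HasDerivAt (fun a => f a y t) (fderiv ℝ (unc f) (x, y, t) (1, 0, 0)) x :=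
  HasFDerivAt.comp_hasDerivAt (l := unc f) (f := fun a => (a, y, t)) x h.hasFDerivAt
    ((hasDerivAt_id x).prodMk ((hasDerivAt_const x y).prodMk (hasDerivAt_const x t)))

lemma hasDerivAt_snd_fderiv (h : DifferentiableAt ℝ (unc f) (x, y, t)) :
    HasDerivAt (fun b => f x b t) (fderiv ℝ (unc f) (x, y, t) (0, 1, 0)) y :=
  HasFDerivAt.comp_hasDerivAt (l := unc f) (f := fun b => (x, b, t)) y h.hasFDerivAt
    ((hasDerivAt_const y x).prodMk ((hasDerivAt_id y).prodMk (hasDerivAt_const y t)))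

lemma hasDerivAt_time_fderiv (h : DifferentiableAt ℝ (unc f) (x, y, t)) :
    HasDerivAt (fun s => f x y s) (fderiv ℝ (unc f) (x, y, t) (0, 0, 1)) t :=
  HasFDerivAt.comp_hasDerivAt (l := unc f) (f := fun s => (x, y, s)) t h.hasFDerivAt
    ((hasDerivAt_const t x).prodMk ((hasDerivAt_const t y).prodMk (hasDerivAt_id t)))

lemma hasDerivAt_pdX (h : DifferentiableAt ℝ (unc f) (x, y, t)) :
    HasDerivAt (fun a => f a y t) (pdX f x y t) x :=
  (hasDerivAt_fst_fderiv h).differentiableAt.hasDerivAt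

lemma hasDerivAt_pdY (h : DifferentiableAt ℝ (unc f) (x, y, t)) :
    HasDerivAt (fun b => f x b t) (pdY f x y t) y :=
  (hasDerivAt_snd_fderiv h).differentiableAt.hasDerivAt

lemma hasDerivAt_pdT (h : DifferentiableAt ℝ (unc f) (x, y, t)) :
    HasDerivAt (fun s => f x y s) (pdT f x y t) t :=
  (hasDerivAt_time_fderiv h).differentiableAt.hasDerivAt

variable {q : ℝ × ℝ × ℝ} {k : ℕ}

lemma contDiffAt_fderiv_apply (h : ContDiffAt ℝ (k + 1) (unc f) q) (v : ℝ × ℝ × ℝ) :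
    ContDiffAt ℝ k (fun z => fderiv ℝ (unc f) z v) q :=
  h.fderiv_right_succ.clm_apply contDiffAt_const

lemma eventually_differentiableAt (h : ContDiffAt ℝ (k + 1) (unc f) q) :
    ∀ᶠ z in nhds q, DifferentiableAt ℝ (unc f) z :=
  (h.eventually (by exact_mod_cast WithTop.coe_injective.ne (ENat.natCast_ne_top (k + 1)))).mono
    fun _ hz => hz.differentiableAt (by positivity)

lemma contDiffAt_pdX (h : ContDiffAt ℝ (k + 1) (unc f) q) :
    ContDiffAt ℝ k (unc (pdX f)) q :=
  (contDiffAt_fderiv_apply h (1, 0, 0)).congr_of_eventuallyEq <|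
    (eventually_differentiableAt h).mono fun _ hz => (hasDerivAt_fst_fderiv hz).deriv

lemma contDiffAt_pdY (h : ContDiffAt ℝ (k + 1) (unc f) q) :
    ContDiffAt ℝ k (unc (pdY f)) q :=
  (contDiffAt_fderiv_apply h (0, 1, 0)).congr_of_eventuallyEq <|
    (eventually_differentiableAt h).mono fun _ hz => (hasDerivAt_snd_fderiv hz).deriv

lemma contDiffAt_pdT (h : ContDiffAt ℝ (k + 1) (unc f) q) :
    ContDiffAt ℝ k (unc (pdT f)) q :=
  (contDiffAt_fderiv_apply h (0, 0, 1)).congr_of_eventuallyEq <|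
    (eventually_differentiableAt h).mono fun _ hz => (hasDerivAt_time_fderiv hz).deriv

end PartialDerivatives

section Integration

variable {Lx Ly 𝒯 : ℝ}

lemma rect_ae_eq : (Ioo (0 : ℝ) Lx ×ˢ Ioo (0 : ℝ) Ly : Set (ℝ × ℝ))
    =ᵐ[volume] Icc (0 : ℝ) Lx ×ˢ Icc (0 : ℝ) Ly :=
  Measure.set_prod_ae_eq Ioo_ae_eq_Icc Ioo_ae_eq_Icc

lemma continuousOn_slice {f : F3} {t : ℝ} {s : Set (ℝ × ℝ)}
    (hf : ∀ q ∈ s, ContinuousAt (unc f) (q.1, q.2, t)) :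
    ContinuousOn (fun q : ℝ × ℝ => f q.1 q.2 t) s := fun q hq =>
  (ContinuousAt.comp (f := fun q : ℝ × ℝ => (q.1, q.2, t)) (hf q hq)
    (by fun_prop)).continuousWithinAt

lemma integrableOn_rect {f : F3} {t : ℝ}
    (hf : ∀ x ∈ Icc 0 Lx, ∀ y ∈ Icc 0 Ly, ContinuousAt (unc f) (x, y, t)) :
    IntegrableOn (fun q : ℝ × ℝ => f q.1 q.2 t) (Ioo 0 Lx ×ˢ Ioo 0 Ly) :=
  ((continuousOn_slice fun q hq => hf q.1 hq.1 q.2 hq.2).integrableOn_compact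
    (isCompact_Icc.prod isCompact_Icc)).mono_set
    (prod_mono Ioo_subset_Icc_self Ioo_subset_Icc_self)

/-- Differentiation in time under the integral over the rectangle. -/
lemma hasDerivAt_integral_rect {U : F3}
    (hU : ∀ x ∈ Icc 0 Lx, ∀ y ∈ Icc 0 Ly, ∀ t ∈ Icc 0 𝒯, ContDiffAt ℝ 1 (unc U) (x, y, t))
    {t : ℝ} (ht : t ∈ Ioo 0 𝒯) :
    HasDerivAt (fun s => ∫ q in Ioo (0 : ℝ) Lx ×ˢ Ioo (0 : ℝ) Ly, U q.1 q.2 s)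
      (∫ q in Ioo (0 : ℝ) Lx ×ˢ Ioo (0 : ℝ) Ly, pdT U q.1 q.2 t) t := by
  have hc : ∀ x ∈ Icc 0 Lx, ∀ y ∈ Icc 0 Ly, ∀ t ∈ Icc 0 𝒯,
      ContinuousAt (unc (pdT U)) (x, y, t) := fun x hx y hy t ht =>
    (contDiffAt_pdT (k := 0) (by simpa using hU x hx y hy t ht)).continuousAt
  obtain ⟨C, hC⟩ := IsCompact.exists_bound_of_continuousOn
    (isCompact_Icc.prod (isCompact_Icc.prod isCompact_Icc)) (s := Icc 0 Lx ×ˢ Icc 0 Ly ×ˢ Icc 0 𝒯)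
    (f := unc (pdT U)) fun q hq => (hc q.1 hq.1 q.2.1 hq.2.1 q.2.2 hq.2.2).continuousWithinAt
  have hint : ∀ s ∈ Ioo 0 𝒯, IntegrableOn (fun q : ℝ × ℝ => U q.1 q.2 s)
      (Ioo 0 Lx ×ˢ Ioo 0 Ly) := fun s hs =>
    integrableOn_rect fun x hx y hy => (hU x hx y hy s (Ioo_subset_Icc_self hs)).continuousAt
  have hnhds : Ioo 0 𝒯 ∈ nhds t := Ioo_mem_nhds ht.1 ht.2
  have hmeas : MeasurableSet (Ioo (0 : ℝ) Lx ×ˢ Ioo (0 : ℝ) Ly) :=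
    measurableSet_Ioo.prod measurableSet_Ioo
  refine (hasDerivAt_integral_of_dominated_loc_of_deriv_le (F := fun s (q : ℝ × ℝ) => U q.1 q.2 s)
    (F' := fun s q => pdT U q.1 q.2 s) (bound := fun _ => C) hnhds
    (Filter.eventually_of_mem hnhds fun s hs => (hint s hs).aestronglyMeasurable) (hint t ht)
    (integrableOn_rect fun x hx y hy =>
      hc x hx y hy t (Ioo_subset_Icc_self ht)).aestronglyMeasurable ?_ ?_ ?_).2
  · refine (ae_restrict_iff' hmeas).2 (Filter.Eventually.of_forall fun q hq s hs => ?_)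
    exact hC (q.1, q.2, s) ⟨Ioo_subset_Icc_self hq.1, Ioo_subset_Icc_self hq.2,
      Ioo_subset_Icc_self hs⟩
  · exact integrableOn_rect (f := fun _ _ _ => C) (t := 0) fun _ _ _ _ => continuousAt_const
  · refine (ae_restrict_iff' hmeas).2 (Filter.Eventually.of_forall fun q hq s hs => ?_)
    exact hasDerivAt_pdT ((hU q.1 (Ioo_subset_Icc_self hq.1) q.2 (Ioo_subset_Icc_self hq.2) s
      (Ioo_subset_Icc_self hs)).differentiableAt one_ne_zero)

/-- The divergence theorem on the rectangle at a fixed time. -/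
lemma integral_divergence_rect (hLx : 0 < Lx) (hLy : 0 < Ly) {F G : F3} {t : ℝ}
    (hF : ∀ x ∈ Icc 0 Lx, ∀ y ∈ Icc 0 Ly, ContDiffAt ℝ 1 (unc F) (x, y, t))
    (hG : ∀ x ∈ Icc 0 Lx, ∀ y ∈ Icc 0 Ly, ContDiffAt ℝ 1 (unc G) (x, y, t)) :
    ∫ q in Ioo (0 : ℝ) Lx ×ˢ Ioo (0 : ℝ) Ly, (pdX F q.1 q.2 t + pdY G q.1 q.2 t)
      = (((∫ x in (0 : ℝ)..Lx, G x Ly t) - ∫ x in (0 : ℝ)..Lx, G x 0 t)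
          + ∫ y in (0 : ℝ)..Ly, F Lx y t) - ∫ y in (0 : ℝ)..Ly, F 0 y t := by
  let ι : ℝ × ℝ → ℝ × ℝ × ℝ := fun q => (q.1, q.2, t)
  have hslice : ∀ {H : F3}, (∀ x ∈ Icc 0 Lx, ∀ y ∈ Icc 0 Ly, ContDiffAt ℝ 1 (unc H) (x, y, t)) →
      ∀ q ∈ Icc 0 Lx ×ˢ Icc 0 Ly, DifferentiableAt ℝ (fun q : ℝ × ℝ => H q.1 q.2 t) q := by
    intro H hH q hq
    have h1 : DifferentiableAt ℝ (unc H) (ι q) :=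
      (hH q.1 hq.1 q.2 hq.2).differentiableAt one_ne_zero
    have h2 : DifferentiableAt ℝ ι q := by fun_prop
    exact h1.comp q h2
  have hX : ∀ q ∈ Icc 0 Lx ×ˢ Icc 0 Ly,
      fderiv ℝ (fun q : ℝ × ℝ => F q.1 q.2 t) q (1, 0) = pdX F q.1 q.2 t := fun q hq =>
    (((hslice hF q hq).hasFDerivAt.comp_hasDerivAt (f := fun a => (a, q.2)) q.1
      ((hasDerivAt_id q.1).prodMk (hasDerivAt_const q.1 q.2))).deriv).symm
  have hY : ∀ q ∈ Icc 0 Lx ×ˢ Icc 0 Ly,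
      fderiv ℝ (fun q : ℝ × ℝ => G q.1 q.2 t) q (0, 1) = pdY G q.1 q.2 t := fun q hq =>
    (((hslice hG q hq).hasFDerivAt.comp_hasDerivAt (f := fun b => (q.1, b)) q.2
      ((hasDerivAt_const q.2 q.1).prodMk (hasDerivAt_id q.2))).deriv).symm
  have hsub : Ioo 0 Lx ×ˢ Ioo 0 Ly ⊆ Icc 0 Lx ×ˢ Icc 0 Ly :=
    prod_mono Ioo_subset_Icc_self Ioo_subset_Icc_self
  have hcongr : EqOn (fun q : ℝ × ℝ => fderiv ℝ (fun q : ℝ × ℝ => F q.1 q.2 t) q (1, 0)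
      + fderiv ℝ (fun q : ℝ × ℝ => G q.1 q.2 t) q (0, 1))
      (fun q => pdX F q.1 q.2 t + pdY G q.1 q.2 t) (Icc 0 Lx ×ˢ Icc 0 Ly) :=
    fun q hq => congrArg₂ (· + ·) (hX q hq) (hY q hq)
  have hcont : ContinuousOn (fun q : ℝ × ℝ => pdX F q.1 q.2 t + pdY G q.1 q.2 t)
      (Icc 0 Lx ×ˢ Icc 0 Ly) :=
    (continuousOn_slice fun q hq => (contDiffAt_pdX (k := 0)
      (by simpa using hF q.1 hq.1 q.2 hq.2)).continuousAt).add
    (continuousOn_slice fun q hq => (contDiffAt_pdY (k := 0)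
      (by simpa using hG q.1 hq.1 q.2 hq.2)).continuousAt)
  have hIcc : Icc ((0 : ℝ), (0 : ℝ)) (Lx, Ly) = Icc 0 Lx ×ˢ Icc 0 Ly :=
    (Icc_prod_Icc 0 Lx 0 Ly).symm
  have h := integral_divergence_prod_Icc_of_hasFDerivAt_of_le
    (fun q : ℝ × ℝ => F q.1 q.2 t) (fun q : ℝ × ℝ => G q.1 q.2 t) _ _ ((0 : ℝ), (0 : ℝ)) (Lx, Ly)
    ⟨hLx.le, hLy.le⟩
    (hIcc ▸ fun q hq => (hslice hF q hq).continuousAt.continuousWithinAt)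
    (hIcc ▸ fun q hq => (hslice hG q hq).continuousAt.continuousWithinAt)
    (fun q hq => (hslice hF q (hsub hq)).hasFDerivAt)
    (fun q hq => (hslice hG q (hsub hq)).hasFDerivAt)
    (hIcc ▸ (hcont.congr hcongr).integrableOn_compact (isCompact_Icc.prod isCompact_Icc))
  rw [setIntegral_congr_set rect_ae_eq,
    ← setIntegral_congr_fun (measurableSet_Icc.prod measurableSet_Icc) hcongr, ← hIcc]
  exact h

end Integration

section Smoothness

variable {γ R μ κ : ℝ} {ρ m n E : F3} {q : ℝ × ℝ × ℝ} {k : WithTop ℕ∞}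

lemma contDiffAt_vel (hr : ContDiffAt ℝ k (unc ρ) q) (hm : ContDiffAt ℝ k (unc m) q)
    (hρ : 0 < unc ρ q) : ContDiffAt ℝ k (unc (velU ρ m)) q :=
  hm.div hr hρ.ne'

lemma contDiffAt_press (hr : ContDiffAt ℝ k (unc ρ) q) (hm : ContDiffAt ℝ k (unc m) q)
    (hn : ContDiffAt ℝ k (unc n) q) (he : ContDiffAt ℝ k (unc E) q) (hρ : 0 < unc ρ q) :
    ContDiffAt ℝ k (unc (press γ ρ m n E)) q :=
  contDiffAt_const.mul (he.sub (((hm.pow 2).add (hn.pow 2)).div (contDiffAt_const.mul hr)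
    (mul_pos two_pos hρ).ne'))

lemma contDiffAt_temp (hR : 0 < R) (hr : ContDiffAt ℝ k (unc ρ) q)
    (hp : ContDiffAt ℝ k (unc (press γ ρ m n E)) q) (hρ : 0 < unc ρ q) :
    ContDiffAt ℝ k (unc (temp γ R ρ m n E)) q :=
  hp.div (hr.mul contDiffAt_const) (mul_pos hρ hR).ne'

lemma contDiffAt_entS (hr : ContDiffAt ℝ k (unc ρ) q)
    (hp : ContDiffAt ℝ k (unc (press γ ρ m n E)) q) (hρ : 0 < unc ρ q)
    (hpos : 0 < unc (press γ ρ m n E) q) :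
    ContDiffAt ℝ k (unc (entS γ R ρ m n E)) q :=
  contDiffAt_const.mul (ContDiffAt.log
    (f := fun q => unc (press γ ρ m n E) q / unc ρ q ^ γ)
    (hp.div (hr.rpow_const_of_ne hρ.ne') (rpow_pos_of_pos hρ γ).ne')
    (div_pos hpos (rpow_pos_of_pos hρ γ)).ne')

lemma contDiffAt_entU (hr : ContDiffAt ℝ k (unc ρ) q)
    (hS : ContDiffAt ℝ k (unc (entS γ R ρ m n E)) q) :
    ContDiffAt ℝ k (unc (entU γ R ρ m n E)) q :=
  hr.neg.mul hS

lemma contDiffAt_wVec (hS : ContDiffAt ℝ k (unc (entS γ R ρ m n E)) q)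
    (hu : ContDiffAt ℝ k (unc (velU ρ m)) q) (hv : ContDiffAt ℝ k (unc (velV ρ n)) q)
    (hT : ContDiffAt ℝ k (unc (temp γ R ρ m n E)) q)
    (hT0 : unc (temp γ R ρ m n E) q ≠ 0) (i : Fin 4) :
    ContDiffAt ℝ k (unc fun a b s => wVec γ R ρ m n E a b s i) q := by
  fin_cases i
  · exact (hS.neg.add contDiffAt_const).sub (((hu.pow 2).add (hv.pow 2)).div
      (contDiffAt_const.mul hT) (mul_ne_zero two_ne_zero hT0))
  · exact hu.div hT hT0
  · exact hv.div hT hT0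
  · exact (contDiffAt_const.div hT hT0).neg

lemma contDiffAt_fIvec (hr : ContDiffAt ℝ k (unc ρ) q) (he : ContDiffAt ℝ k (unc E) q)
    (hu : ContDiffAt ℝ k (unc (velU ρ m)) q) (hv : ContDiffAt ℝ k (unc (velV ρ n)) q)
    (hp : ContDiffAt ℝ k (unc (press γ ρ m n E)) q) (i : Fin 4) :
    ContDiffAt ℝ k (unc fun a b s => fIvec γ ρ m n E a b s i) q := by
  fin_cases i
  · exact hr.mul hu
  · exact (hr.mul (hu.pow 2)).add hp
  · exact (hr.mul hu).mul hv
  · exact hu.mul (he.add hp)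

lemma contDiffAt_gIvec (hr : ContDiffAt ℝ k (unc ρ) q) (he : ContDiffAt ℝ k (unc E) q)
    (hu : ContDiffAt ℝ k (unc (velU ρ m)) q) (hv : ContDiffAt ℝ k (unc (velV ρ n)) q)
    (hp : ContDiffAt ℝ k (unc (press γ ρ m n E)) q) (i : Fin 4) :
    ContDiffAt ℝ k (unc fun a b s => gIvec γ ρ m n E a b s i) q := by
  fin_cases i
  · exact hr.mul hv
  · exact (hr.mul hu).mul hv
  · exact (hr.mul (hv.pow 2)).add hp
  · exact hv.mul (he.add hp)

lemma contDiffAt_viscous (hu : ContDiffAt ℝ 2 (unc (velU ρ m)) q)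
    (hv : ContDiffAt ℝ 2 (unc (velV ρ n)) q)
    (hT : ContDiffAt ℝ 2 (unc (temp γ R ρ m n E)) q) (i : Fin 4) :
    ContDiffAt ℝ 1 (unc fun a b s => fVvec γ R μ κ ρ m n E a b s i) q ∧
      ContDiffAt ℝ 1 (unc fun a b s => gVvec γ R μ κ ρ m n E a b s i) q := by
  have h2 : ((1 : ℕ) : WithTop ℕ∞) + 1 = 2 := by norm_num
  have hux := contDiffAt_pdX (k := 1) (h2 ▸ hu)
  have huy := contDiffAt_pdY (k := 1) (h2 ▸ hu)
  have hvx := contDiffAt_pdX (k := 1) (h2 ▸ hv)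
  have hvy := contDiffAt_pdY (k := 1) (h2 ▸ hv)
  have hTx := contDiffAt_pdX (k := 1) (h2 ▸ hT)
  have hTy := contDiffAt_pdY (k := 1) (h2 ▸ hT)
  rw [Nat.cast_one] at hux huy hvx hvy hTx hTy
  have hxx : ContDiffAt ℝ 1 (unc (tauXX μ ρ m n)) q :=
    contDiffAt_const.mul ((contDiffAt_const.mul hux).sub (contDiffAt_const.mul hvy))
  have hxy : ContDiffAt ℝ 1 (unc (tauXY μ ρ m n)) q := contDiffAt_const.mul (huy.add hvx)
  have hyy : ContDiffAt ℝ 1 (unc (tauYY μ ρ m n)) q :=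
    contDiffAt_const.mul ((contDiffAt_const.mul hvy).sub (contDiffAt_const.mul hux))
  have hu1 := hu.of_le one_le_two
  have hv1 := hv.of_le one_le_two
  fin_cases i
  · exact ⟨contDiffAt_const, contDiffAt_const⟩
  · exact ⟨hxx, hxy⟩
  · exact ⟨hxy, hyy⟩
  · exact ⟨((hu1.mul hxx).add (hv1.mul hxy)).add (contDiffAt_const.mul hTx),
      ((hu1.mul hxy).add (hv1.mul hyy)).add (contDiffAt_const.mul hTy)⟩

end Smoothness

section Balance

variable (γ R μ κ : ℝ) (ρ m n E : F3)

/-- The entropy flux `w · (f^I − f^V) − ψ^x` in the `x`-direction. -/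
def entFluxX : F3 := fun x y t =>
  (∑ k, wVec γ R ρ m n E x y t k *
    (fIvec γ ρ m n E x y t k - fVvec γ R μ κ ρ m n E x y t k)) - psiX γ R ρ m x y t

/-- The entropy flux `w · (g^I − g^V) − ψ^y` in the `y`-direction. -/
def entFluxY : F3 := fun x y t =>
  (∑ k, wVec γ R ρ m n E x y t k *
    (gIvec γ ρ m n E x y t k - gVvec γ R μ κ ρ m n E x y t k)) - psiY γ R ρ n x y t

/-- The entropy dissipation density `∂_x w · f^V + ∂_y w · g^V`. -/
def entDissip : F3 := fun x y t =>
  ∑ k, (pdX (fun a b s => wVec γ R ρ m n E a b s k) x y t * fVvec γ R μ κ ρ m n E x y t k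
    + pdY (fun a b s => wVec γ R ρ m n E a b s k) x y t * gVvec γ R μ κ ρ m n E x y t k)

variable {γ R μ κ ρ m n E}

/-- Regularity of the entropy, its fluxes and its dissipation at an admissible point, together
with the pointwise entropy balance where the Navier–Stokes equations hold. -/
lemma entropy_balance_at (hγ : 1 < γ) (hR : 0 < R) {x y t : ℝ}
    (hr : ContDiffAt ℝ 2 (unc ρ) (x, y, t)) (hm : ContDiffAt ℝ 2 (unc m) (x, y, t))
    (hn : ContDiffAt ℝ 2 (unc n) (x, y, t)) (he : ContDiffAt ℝ 2 (unc E) (x, y, t))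
    (hρ : 0 < ρ x y t) (hpos : 0 < press γ ρ m n E x y t) :
    ContDiffAt ℝ 1 (unc (entU γ R ρ m n E)) (x, y, t) ∧
    ContDiffAt ℝ 1 (unc (entFluxX γ R μ κ ρ m n E)) (x, y, t) ∧
    ContDiffAt ℝ 1 (unc (entFluxY γ R μ κ ρ m n E)) (x, y, t) ∧
    ContinuousAt (unc (entDissip γ R μ κ ρ m n E)) (x, y, t) ∧
    (isNSsol γ R μ κ ρ m n E x y t →
      pdT (entU γ R ρ m n E) x y t = -entDissip γ R μ κ ρ m n E x y t
        - (pdX (entFluxX γ R μ κ ρ m n E) x y t + pdY (entFluxY γ R μ κ ρ m n E) x y t)) := by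
  have hu : ContDiffAt ℝ 2 (unc (velU ρ m)) (x, y, t) := contDiffAt_vel hr hm hρ
  have hv : ContDiffAt ℝ 2 (unc (velV ρ n)) (x, y, t) := contDiffAt_vel hr hn hρ
  have hp : ContDiffAt ℝ 2 (unc (press γ ρ m n E)) (x, y, t) := contDiffAt_press hr hm hn he hρ
  have hT : ContDiffAt ℝ 2 (unc (temp γ R ρ m n E)) (x, y, t) := contDiffAt_temp hR hr hp hρ
  have hT0 : unc (temp γ R ρ m n E) (x, y, t) ≠ 0 := (div_pos hpos (mul_pos hρ hR)).ne'
  have hS : ContDiffAt ℝ 2 (unc (entS γ R ρ m n E)) (x, y, t) := contDiffAt_entS hr hp hρ hpos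
  have hU := (contDiffAt_entU hr hS).of_le one_le_two
  have hw := contDiffAt_wVec hS hu hv hT hT0
  have hw1 := fun i => (hw i).of_le one_le_two
  have hfI := fun i => (contDiffAt_fIvec hr he hu hv hp i).of_le one_le_two
  have hgI := fun i => (contDiffAt_gIvec hr he hu hv hp i).of_le one_le_two
  have hfV := fun i => (contDiffAt_viscous (μ := μ) (κ := κ) hu hv hT i).1
  have hgV := fun i => (contDiffAt_viscous (μ := μ) (κ := κ) hu hv hT i).2
  have hψx : ContDiffAt ℝ 1 (unc (psiX γ R ρ m)) (x, y, t) :=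
    (contDiffAt_const.mul (hr.mul hu)).of_le one_le_two
  have hψy : ContDiffAt ℝ 1 (unc (psiY γ R ρ n)) (x, y, t) :=
    (contDiffAt_const.mul (hr.mul hv)).of_le one_le_two
  have hF : ContDiffAt ℝ 1 (unc (entFluxX γ R μ κ ρ m n E)) (x, y, t) :=
    (ContDiffAt.sum fun i _ => (hw1 i).mul ((hfI i).sub (hfV i))).sub hψx
  have hG : ContDiffAt ℝ 1 (unc (entFluxY γ R μ κ ρ m n E)) (x, y, t) :=
    (ContDiffAt.sum fun i _ => (hw1 i).mul ((hgI i).sub (hgV i))).sub hψy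
  refine ⟨hU, hF, hG, ?_, fun hNS => ?_⟩
  · have hwx := fun i => contDiffAt_pdX (k := 0) (by simpa using hw1 i)
    have hwy := fun i => contDiffAt_pdY (k := 0) (by simpa using hw1 i)
    have h := ContDiffAt.sum (s := Finset.univ) fun i _ =>
      ((hwx i).mul ((hfV i).of_le (by simp))).add
        ((hwy i).mul ((hgV i).of_le (by simp)))
    exact h.continuousAt
  have d {f : F3} (h : ContDiffAt ℝ 1 (unc f) (x, y, t)) := h.differentiableAt one_ne_zero
  have d2 {f : F3} (h : ContDiffAt ℝ 2 (unc f) (x, y, t)) := h.differentiableAt two_ne_zero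
  have hFx : pdX (entFluxX γ R μ κ ρ m n E) x y t = _ :=
    ((HasDerivAt.fun_sum (u := Finset.univ) fun i _ => (hasDerivAt_pdX (d (hw1 i))).mul
      ((hasDerivAt_pdX (d (hfI i))).sub (hasDerivAt_pdX (d (hfV i))))).sub
      (hasDerivAt_pdX (d hψx))).deriv
  have hGy : pdY (entFluxY γ R μ κ ρ m n E) x y t = _ :=
    ((HasDerivAt.fun_sum (u := Finset.univ) fun i _ => (hasDerivAt_pdY (d (hw1 i))).mul
      ((hasDerivAt_pdY (d (hgI i))).sub (hasDerivAt_pdY (d (hgV i))))).sub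
      (hasDerivAt_pdY (d hψy))).deriv
  have hUt : pdT (entU γ R ρ m n E) x y t = _ :=
    (hasDerivAt_entU_curve (X := fun _ => x) (Y := fun _ => y) (Z := fun s => s) hγ
      (hasDerivAt_pdT (d2 hr)) (hasDerivAt_pdT (d2 hm)) (hasDerivAt_pdT (d2 hn))
      (hasDerivAt_pdT (d2 he)) hρ hpos).deriv
  have hIx : ∑ k, pdX (fun a b s => wVec γ R ρ m n E a b s k) x y t * fIvec γ ρ m n E x y t k
      = pdX (psiX γ R ρ m) x y t :=
    sum_deriv_wVec_mul_fIvec (X := fun a => a) (Y := fun _ => y) (Z := fun _ => t) hγ hR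
      (hasDerivAt_pdX (d2 hr)) (hasDerivAt_pdX (d2 hm)) (hasDerivAt_pdX (d2 hn))
      (hasDerivAt_pdX (d2 he)) hρ hpos
  have hIy : ∑ k, pdY (fun a b s => wVec γ R ρ m n E a b s k) x y t * gIvec γ ρ m n E x y t k
      = pdY (psiY γ R ρ n) x y t :=
    sum_deriv_wVec_mul_gIvec (X := fun _ => x) (Y := fun b => b) (Z := fun _ => t) hγ hR
      (hasDerivAt_pdY (d2 hr)) (hasDerivAt_pdY (d2 hm)) (hasDerivAt_pdY (d2 hn))
      (hasDerivAt_pdY (d2 he)) hρ hpos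
  have hcons : ∀ k, pdT (fun a b s => consVec ρ m n E a b s k) x y t
      = ![pdT ρ x y t, pdT m x y t, pdT n x y t, pdT E x y t] k := by
    intro k
    fin_cases k <;> rfl
  rw [hFx, hGy, hUt, ← hIx, ← hIy, entDissip, ← Finset.sum_sub_distrib, ← Finset.sum_sub_distrib,
    ← Finset.sum_add_distrib, ← Finset.sum_neg_distrib, ← Finset.sum_sub_distrib]
  refine Finset.sum_congr rfl fun k _ => ?_
  have hk := hNS k
  rw [← hcons]
  simp only [Pi.sub_apply]
  linear_combination wVec γ R ρ m n E x y t k * hk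

end Balance

/-- the entropy balance identity for admissible C² classical solutions of
the 2-D compressible Navier–Stokes equations on the rectangle `Ω = (0,Lx)×(0,Ly)`:
for every `t ∈ (0,𝒯)`,
`d/dt ∫_Ω U + ∫_Ω (∂_x w · f^V + ∂_y w · g^V) = −∮_{∂Ω} [w·(n¹(f^I−f^V)+n²(g^I−g^V)) − (n¹ψ^x+n²ψ^y)] ds`,
the boundary integral being the sum of the line integrals over the four sides of the
rectangle with outward normals. -/
theorem stmt_3 (Lx Ly 𝒯 γ R μ κ : ℝ)
    (hLx : 0 < Lx) (hLy : 0 < Ly) (h𝒯 : 0 < 𝒯) (hγ : 1 < γ) (hR : 0 < R)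
    (hμ : 0 ≤ μ) (hκ : 0 ≤ κ)
    (ρ m n E : F3)
    (hreg : ∀ f ∈ [ρ, m, n, E], ContDiff ℝ 2 (fun q : ℝ × ℝ × ℝ => f q.1 q.2.1 q.2.2))
    (hadm : ∀ x ∈ Icc 0 Lx, ∀ y ∈ Icc 0 Ly, ∀ t ∈ Icc 0 𝒯,
      0 < ρ x y t ∧ 0 < press γ ρ m n E x y t)
    (hNS : ∀ x ∈ Icc 0 Lx, ∀ y ∈ Icc 0 Ly, ∀ t ∈ Icc 0 𝒯,
      isNSsol γ R μ κ ρ m n E x y t) :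
    ∀ t ∈ Ioo 0 𝒯,
      HasDerivAt
        (fun s => ∫ q in Ioo (0 : ℝ) Lx ×ˢ Ioo (0 : ℝ) Ly, entU γ R ρ m n E q.1 q.2 s)
        (-(∫ q in Ioo (0 : ℝ) Lx ×ˢ Ioo (0 : ℝ) Ly,
            ∑ k, (pdX (fun a b s => wVec γ R ρ m n E a b s k) q.1 q.2 t
                    * fVvec γ R μ κ ρ m n E q.1 q.2 t k
                  + pdY (fun a b s => wVec γ R ρ m n E a b s k) q.1 q.2 t
                    * gVvec γ R μ κ ρ m n E q.1 q.2 t k))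
          - ((∫ y in (0 : ℝ)..Ly,
                ((∑ k, wVec γ R ρ m n E Lx y t k *
                    (fIvec γ ρ m n E Lx y t k - fVvec γ R μ κ ρ m n E Lx y t k))
                  - psiX γ R ρ m Lx y t))
             + (∫ y in (0 : ℝ)..Ly,
                (-(∑ k, wVec γ R ρ m n E 0 y t k *
                    (fIvec γ ρ m n E 0 y t k - fVvec γ R μ κ ρ m n E 0 y t k))
                  + psiX γ R ρ m 0 y t))
             + (∫ x in (0 : ℝ)..Lx,
                ((∑ k, wVec γ R ρ m n E x Ly t k *
                    (gIvec γ ρ m n E x Ly t k - gVvec γ R μ κ ρ m n E x Ly t k))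
                  - psiY γ R ρ n x Ly t))
             + (∫ x in (0 : ℝ)..Lx,
                (-(∑ k, wVec γ R ρ m n E x 0 t k *
                    (gIvec γ ρ m n E x 0 t k - gVvec γ R μ κ ρ m n E x 0 t k))
                  + psiY γ R ρ n x 0 t))))
        t := by
  intro t ht
  have hbal := fun x (hx : x ∈ Icc 0 Lx) y (hy : y ∈ Icc 0 Ly) t (ht : t ∈ Icc 0 𝒯) =>
    entropy_balance_at (μ := μ) (κ := κ) hγ hR (x := x) (y := y) (t := t)
      (hreg ρ (by simp)).contDiffAt (hreg m (by simp)).contDiffAt (hreg n (by simp)).contDiffAt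
      (hreg E (by simp)).contDiffAt (hadm x hx y hy t ht).1 (hadm x hx y hy t ht).2
  have htI := Ioo_subset_Icc_self ht
  have hF := fun x hx y hy => (hbal x hx y hy t htI).2.1
  have hG := fun x hx y hy => (hbal x hx y hy t htI).2.2.1
  refine (hasDerivAt_integral_rect (fun x hx y hy t ht => (hbal x hx y hy t ht).1) ht).congr_deriv ?_
  have hdiss := integrableOn_rect fun x hx y hy => (hbal x hx y hy t htI).2.2.2.1
  have hdiv := (integrableOn_rect fun x hx y hy =>
    (contDiffAt_pdX (k := 0) (by simpa using hF x hx y hy)).continuousAt).add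
    (integrableOn_rect fun x hx y hy =>
      (contDiffAt_pdY (k := 0) (by simpa using hG x hx y hy)).continuousAt)
  have hpt : EqOn (fun q : ℝ × ℝ => pdT (entU γ R ρ m n E) q.1 q.2 t)
      (fun q => -entDissip γ R μ κ ρ m n E q.1 q.2 t
        - (pdX (entFluxX γ R μ κ ρ m n E) q.1 q.2 t
          + pdY (entFluxY γ R μ κ ρ m n E) q.1 q.2 t)) (Ioo 0 Lx ×ˢ Ioo 0 Ly) := fun q hq => by
    have hx := Ioo_subset_Icc_self hq.1
    have hy := Ioo_subset_Icc_self hq.2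
    exact (hbal q.1 hx q.2 hy t htI).2.2.2.2 (hNS q.1 hx q.2 hy t htI)
  have hsplit := integral_sub hdiss.neg hdiv
  simp only [Pi.neg_apply, Pi.add_apply] at hsplit
  rw [setIntegral_congr_fun (measurableSet_Ioo.prod measurableSet_Ioo) hpt, hsplit,
    MeasureTheory.integral_neg, integral_divergence_rect hLx hLy hF hG]
  have hneg : ∀ (c : ℝ) (f : ℝ → ℝ) (g : ℝ → ℝ),
      ∫ z in (0 : ℝ)..c, (-f z + g z) = -∫ z in (0 : ℝ)..c, (f z - g z) := fun c f g => by
    rw [← intervalIntegral.integral_neg]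
    exact intervalIntegral.integral_congr fun z _ => by ring
  simp only [hneg]
  simp only [entFluxX, entFluxY, entDissip]
  ring
end
end

section
/- For every admissible state (ρ,m,n,E) (i.e. ρ > 0 and p > 0), the entropy flux potential identities hold: w · f^I − F = c_v(γ−1) ρ u and w · g^I − G = c_v(γ−1) ρ v, where · denotes the Euclidean inner product on ℝ⁴. -/
/-- The entropy flux potential identity in the first coordinate direction, written in the primitive
variables. -/
lemma entropy_flux_potential {γ ρ p : ℝ} (hγ : γ - 1 ≠ 0) (hρ : ρ ≠ 0) (hp : p ≠ 0)
    (R u v E S : ℝ) (hE : E = p / (γ - 1) + ρ * (u ^ 2 + v ^ 2) / 2) :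
    (-S + R / (γ - 1) * γ - (u ^ 2 + v ^ 2) / (2 * (p / (ρ * R)))) * (ρ * u)
      + u / (p / (ρ * R)) * (ρ * u ^ 2 + p) + v / (p / (ρ * R)) * (ρ * u * v)
      + -(1 / (p / (ρ * R))) * (u * (E + p)) - -(ρ * u * S)
      = R / (γ - 1) * (γ - 1) * ρ * u := by
  subst hE
  field_simp
  ring

/-- the entropy flux potential identities
`w · f^I − F = c_v (γ−1) ρ u` and `w · g^I − G = c_v (γ−1) ρ v`
for every admissible state. -/
theorem stmt_5 (γ R ρ m n E : ℝ) (hγ : 1 < γ) (hR : 0 < R) (hρ : 0 < ρ)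
    (hp : 0 < (γ - 1) * (E - (m ^ 2 + n ^ 2) / (2 * ρ))) :
    let cv := R / (γ - 1)
    let u := m / ρ
    let v := n / ρ
    let p := (γ - 1) * (E - (m ^ 2 + n ^ 2) / (2 * ρ))
    let T := p / (ρ * R)
    let S := cv * Real.log (p / ρ ^ γ)
    let w : Fin 4 → ℝ := ![-S + cv * γ - (u ^ 2 + v ^ 2) / (2 * T), u / T, v / T, -(1 / T)]
    let fI : Fin 4 → ℝ := ![ρ * u, ρ * u ^ 2 + p, ρ * u * v, u * (E + p)]
    let gI : Fin 4 → ℝ := ![ρ * v, ρ * u * v, ρ * v ^ 2 + p, v * (E + p)]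
    let F := -(ρ * u * S)
    let G := -(ρ * v * S)
    (∑ k, w k * fI k) - F = cv * (γ - 1) * ρ * u ∧
    (∑ k, w k * gI k) - G = cv * (γ - 1) * ρ * v := by
  intro cv u v p T S w fI gI F G
  have hγ' : γ - 1 ≠ 0 := (sub_pos.2 hγ).ne'
  have hE : E = p / (γ - 1) + ρ * (u ^ 2 + v ^ 2) / 2 := by
    simp only [p, u, v]
    field_simp
    ring
  have hE' : E = p / (γ - 1) + ρ * (v ^ 2 + u ^ 2) / 2 := by rw [hE, add_comm (u ^ 2)]
  have hf := entropy_flux_potential hγ' hρ.ne' hp.ne' R u v E S hE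
  have hg := entropy_flux_potential hγ' hρ.ne' hp.ne' R v u E S hE'
  constructor
  · rw [Fin.sum_univ_four]
    exact hf
  · rw [Fin.sum_univ_four]
    refine Eq.trans ?_ hg
    change (-S + cv * γ - (u ^ 2 + v ^ 2) / (2 * T)) * (ρ * v) + u / T * (ρ * u * v)
      + v / T * (ρ * v ^ 2 + p) + -(1 / T) * (v * (E + p)) - -(ρ * v * S)
      = (-S + cv * γ - (v ^ 2 + u ^ 2) / (2 * T)) * (ρ * v) + v / T * (ρ * v ^ 2 + p)
      + u / T * (ρ * v * u) + -(1 / T) * (v * (E + p)) - -(ρ * v * S)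
    ring
end

section
/- Let O = {(ρ,m,n,E) ∈ ℝ⁴ : ρ > 0 and E − (m²+n²)/(2ρ) > 0}. Regard the entropy fluxes F = −ρuS, G = −ρvS and the inviscid Euler fluxes f^I = (ρu, ρu²+p, ρuv, u(E+p)), g^I = (ρv, ρuv, ρv²+p, v(E+p)) as smooth maps of the conservative variables on O. Then at every point a ∈ O the entropy/entropy-flux compatibility relations hold: the derivative of F at a equals the composition of the inner product with w(a) with the derivative of f^I at a, and likewise the derivative of G at a equals the inner product with w(a) composed with the derivative of g^I at a; that is, for all h ∈ ℝ⁴, DF(a)[h] = w(a) · Df^I(a)[h] and DG(a)[h] = w(a) · Dg^I(a)[h]. -/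
noncomputable section

/-- Velocity `u = m/ρ` of a conservative state. -/
def stU (a : Fin 4 → ℝ) : ℝ := a 1 / a 0
/-- Velocity `v = n/ρ` of a conservative state. -/
def stV (a : Fin 4 → ℝ) : ℝ := a 2 / a 0
/-- Pressure `p = (γ−1)(E − (m²+n²)/(2ρ))`. -/
def stP (γ : ℝ) (a : Fin 4 → ℝ) : ℝ := (γ - 1) * (a 3 - (a 1 ^ 2 + a 2 ^ 2) / (2 * a 0))
/-- Temperature `T = p/(ρR)`. -/
def stT (γ R : ℝ) (a : Fin 4 → ℝ) : ℝ := stP γ a / (a 0 * R)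
/-- Specific entropy `S = c_v ln(p/ρ^γ)` with `c_v = R/(γ−1)`. -/
def stS (γ R : ℝ) (a : Fin 4 → ℝ) : ℝ := (R / (γ - 1)) * Real.log (stP γ a / a 0 ^ γ)
/-- Entropy variables `w`. -/
def stW (γ R : ℝ) (a : Fin 4 → ℝ) : Fin 4 → ℝ :=
  ![-stS γ R a + (R / (γ - 1)) * γ - (stU a ^ 2 + stV a ^ 2) / (2 * stT γ R a),
    stU a / stT γ R a, stV a / stT γ R a, -(1 / stT γ R a)]
/-- Entropy flux `F = −ρuS`. -/
def stF (γ R : ℝ) (a : Fin 4 → ℝ) : ℝ := -(a 0 * stU a * stS γ R a)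
/-- Entropy flux `G = −ρvS`. -/
def stG (γ R : ℝ) (a : Fin 4 → ℝ) : ℝ := -(a 0 * stV a * stS γ R a)
/-- Inviscid Euler flux `f^I = (ρu, ρu²+p, ρuv, u(E+p))`. -/
def stFI (γ : ℝ) (a : Fin 4 → ℝ) : Fin 4 → ℝ :=
  ![a 0 * stU a, a 0 * stU a ^ 2 + stP γ a, a 0 * stU a * stV a, stU a * (a 3 + stP γ a)]
/-- Inviscid Euler flux `g^I = (ρv, ρuv, ρv²+p, v(E+p))`. -/
def stGI (γ : ℝ) (a : Fin 4 → ℝ) : Fin 4 → ℝ :=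
  ![a 0 * stV a, a 0 * stU a * stV a, a 0 * stV a ^ 2 + stP γ a, stV a * (a 3 + stP γ a)]

theorem hasFDerivAt_div {E : Type*} [NormedAddCommGroup E] [NormedSpace ℝ E] {f g : E → ℝ}
    {f' g' : E →L[ℝ] ℝ} {x : E} (hf : HasFDerivAt f f' x) (hg : HasFDerivAt g g' x)
    (hx : g x ≠ 0) :
    HasFDerivAt (fun y => f y / g y) ((g x)⁻¹ • (f' - (f x / g x) • g')) x := by
  have key := hf.fun_mul ((hasDerivAt_inv hx).comp_hasFDerivAt x hg)
  simp only [Function.comp_apply, ← div_eq_mul_inv] at key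
  refine key.congr_fderiv ?_
  ext h
  simp
  field_simp
  ring

theorem hasFDerivAt_vec4 {E : Type*} [NormedAddCommGroup E] [NormedSpace ℝ E]
    {f₀ f₁ f₂ f₃ : E → ℝ} {f₀' f₁' f₂' f₃' : E →L[ℝ] ℝ} {x : E} (h₀ : HasFDerivAt f₀ f₀' x)
    (h₁ : HasFDerivAt f₁ f₁' x) (h₂ : HasFDerivAt f₂ f₂' x) (h₃ : HasFDerivAt f₃ f₃' x) :
    HasFDerivAt (fun y => ![f₀ y, f₁ y, f₂ y, f₃ y])
      (ContinuousLinearMap.pi ![f₀', f₁', f₂', f₃']) x := by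
  refine hasFDerivAt_pi'.2 fun i => ?_
  fin_cases i
  exacts [h₀, h₁, h₂, h₃]

theorem hasFDerivAt_stU {a : Fin 4 → ℝ} (ha : a 0 ≠ 0) :
    HasFDerivAt stU ((a 0)⁻¹ • (ContinuousLinearMap.proj 1 - stU a • ContinuousLinearMap.proj 0) :
      (Fin 4 → ℝ) →L[ℝ] ℝ) a :=
  hasFDerivAt_div (hasFDerivAt_apply 1 a) (hasFDerivAt_apply 0 a) ha

theorem hasFDerivAt_stV {a : Fin 4 → ℝ} (ha : a 0 ≠ 0) :
    HasFDerivAt stV ((a 0)⁻¹ • (ContinuousLinearMap.proj 2 - stV a • ContinuousLinearMap.proj 0) :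
      (Fin 4 → ℝ) →L[ℝ] ℝ) a :=
  hasFDerivAt_div (hasFDerivAt_apply 2 a) (hasFDerivAt_apply 0 a) ha

theorem hasFDerivAt_stP (γ : ℝ) {a : Fin 4 → ℝ} (ha : a 0 ≠ 0) :
    HasFDerivAt (stP γ) ((γ - 1) • (ContinuousLinearMap.proj 3 - stU a • ContinuousLinearMap.proj 1
      - stV a • ContinuousLinearMap.proj 2
      + ((stU a ^ 2 + stV a ^ 2) / 2) • ContinuousLinearMap.proj 0) :
      (Fin 4 → ℝ) →L[ℝ] ℝ) a := by
  have h2 : 2 * a 0 ≠ 0 := mul_ne_zero two_ne_zero ha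
  refine (((hasFDerivAt_apply (𝕜 := ℝ) 3 a).fun_sub
    (hasFDerivAt_div (((hasFDerivAt_apply 1 a).pow 2).fun_add ((hasFDerivAt_apply 2 a).pow 2))
      ((hasFDerivAt_apply 0 a).const_mul 2) h2)).const_mul (γ - 1)).congr_fderiv ?_
  ext h
  simp [stU, stV]
  field_simp
  ring

theorem hasFDerivAt_stS (γ R : ℝ) {a : Fin 4 → ℝ} (ha : 0 < a 0) (hp : 0 < stP γ a)
    {p' : (Fin 4 → ℝ) →L[ℝ] ℝ} (hp' : HasFDerivAt (stP γ) p' a) :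
    HasFDerivAt (stS γ R) ((R / (γ - 1)) • ((stP γ a)⁻¹ • p'
      - (γ / a 0) • ContinuousLinearMap.proj 0)) a := by
  have key := ((hp'.log hp.ne').fun_sub
    (((hasFDerivAt_apply (𝕜 := ℝ) 0 a).log ha.ne').const_mul γ)).const_mul (R / (γ - 1))
  refine (key.congr_of_eventuallyEq ?_).congr_fderiv ?_
  · filter_upwards [(continuous_apply 0).continuousAt.eventually_const_lt ha,
      hp'.continuousAt.eventually_const_lt hp] with b hb hpb
    rw [stS, Real.log_div hpb.ne' (Real.rpow_pos_of_pos hb γ).ne', Real.log_rpow hb]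
  · ext h
    simp [div_eq_mul_inv, mul_assoc]

/-- the entropy/entropy-flux compatibility relations
`DF(a)[h] = w(a) · Df^I(a)[h]` and `DG(a)[h] = w(a) · Dg^I(a)[h]`
at every admissible conservative state `a ∈ O`. -/
theorem stmt_7 (γ R : ℝ) (hγ : 1 < γ) (hR : 0 < R) :
    ∀ a : Fin 4 → ℝ, 0 < a 0 → 0 < a 3 - (a 1 ^ 2 + a 2 ^ 2) / (2 * a 0) →
      ∀ h : Fin 4 → ℝ,
        fderiv ℝ (stF γ R) a h = ∑ k, stW γ R a k * fderiv ℝ (stFI γ) a h k ∧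
        fderiv ℝ (stG γ R) a h = ∑ k, stW γ R a k * fderiv ℝ (stGI γ) a h k := by
  intro a ha hE h
  have hγ' : γ - 1 ≠ 0 := (sub_pos.2 hγ).ne'
  have hp : 0 < stP γ a := mul_pos (sub_pos.2 hγ) hE
  have hρ := hasFDerivAt_apply (𝕜 := ℝ) 0 a
  have h3 := hasFDerivAt_apply (𝕜 := ℝ) 3 a
  have hU := hasFDerivAt_stU ha.ne'
  have hV := hasFDerivAt_stV ha.ne'
  have hP := hasFDerivAt_stP γ ha.ne'
  have hS := hasFDerivAt_stS γ R ha hp hP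
  have hF : HasFDerivAt (stF γ R) _ a := ((hρ.fun_mul hU).fun_mul hS).fun_neg
  have hG : HasFDerivAt (stG γ R) _ a := ((hρ.fun_mul hV).fun_mul hS).fun_neg
  have hFI : HasFDerivAt (stFI γ) _ a :=
    hasFDerivAt_vec4 (hρ.fun_mul hU) ((hρ.fun_mul (hU.pow 2)).fun_add hP)
      ((hρ.fun_mul hU).fun_mul hV) (hU.fun_mul (h3.fun_add hP))
  have hGI : HasFDerivAt (stGI γ) _ a :=
    hasFDerivAt_vec4 (hρ.fun_mul hV) ((hρ.fun_mul hU).fun_mul hV)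
      ((hρ.fun_mul (hV.pow 2)).fun_add hP) (hV.fun_mul (h3.fun_add hP))
  have hE' : a 3 = stP γ a / (γ - 1) + a 0 * (stU a ^ 2 + stV a ^ 2) / 2 := by
    simp only [stP, stU, stV]
    field_simp
    ring
  rw [hF.fderiv, hG.fderiv, hFI.fderiv, hGI.fderiv]
  simp only [Fin.sum_univ_four, stW, stT, ContinuousLinearMap.pi_apply]
  simp [hE']
  generalize stP γ a = p at *
  generalize stU a = u at *
  generalize stV a = v at *
  generalize stS γ R a = S at *
  constructor <;>
  · field_simp
    ring
end
end

section
/- Let γ > 1 and c_v > 0, and let O = {(ρ,m,n,E) ∈ ℝ⁴ : ρ > 0 and E − (m²+n²)/(2ρ) > 0}. Then the entropy function U(ρ,m,n,E) = −ρ c_v ln(p/ρ^γ), where p = (γ−1)(E − (m²+n²)/(2ρ)), is strictly convex on O. -/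
/-- Supporting hyperplane of `(r, e) ↦ r (γ log r - log e)` at `(R, E)`, touching only there. -/
lemma mul_log_sub_log_gt_tangent {γ r e R E : ℝ} (hγ : 1 < γ) (hr : 0 < r) (he : 0 < e)
    (hR : 0 < R) (hE : 0 < E) (hne : r ≠ R ∨ e ≠ E) :
    r * (γ * Real.log R - Real.log E) + (γ - 1) * (r - R) + (r - R * e / E) <
      r * (γ * Real.log r - Real.log e) := by
  have hlog₁ : Real.log (R / r) = Real.log R - Real.log r := Real.log_div hR.ne' hr.ne'
  have hlog₂ : Real.log (R * e / (r * E)) =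
      Real.log R + Real.log e - (Real.log r + Real.log E) := by
    rw [Real.log_div (by positivity) (by positivity), Real.log_mul hR.ne' he.ne',
      Real.log_mul hr.ne' hE.ne']
  have hmul₁ : r * (R / r - 1) = R - r := by field_simp
  have hmul₂ : r * (R * e / (r * E) - 1) = R * e / E - r := by field_simp
  have hle₁ : r * Real.log (R / r) ≤ R - r :=
    hmul₁ ▸ mul_le_mul_of_nonneg_left (Real.log_le_sub_one_of_pos (by positivity)) hr.le
  have hle₂ : r * Real.log (R * e / (r * E)) ≤ R * e / E - r :=
    hmul₂ ▸ mul_le_mul_of_nonneg_left (Real.log_le_sub_one_of_pos (by positivity)) hr.le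
  by_cases hrR : r = R
  · have heE : e ≠ E := hne.resolve_left (not_not.mpr hrR)
    have hlt : r * Real.log (R * e / (r * E)) < R * e / E - r := by
      refine hmul₂ ▸ mul_lt_mul_of_pos_left
        (Real.log_lt_sub_one_of_pos (by positivity) fun h => heE ?_) hr
      subst hrR
      field_simp at h
      exact h
    rw [hlog₂] at hlt
    subst hrR
    linarith
  · have hlt : r * Real.log (R / r) < R - r := by
      refine hmul₁ ▸ mul_lt_mul_of_pos_left
        (Real.log_lt_sub_one_of_pos (by positivity) fun h => hrR ?_) hr
      field_simp at h
      exact h.symm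
    rw [hlog₁] at hlt
    rw [hlog₂] at hle₂
    linarith [mul_lt_mul_of_pos_left hlt (sub_pos.mpr hγ)]

lemma mul_log_sub_log_ge_tangent {γ r e R E : ℝ} (hγ : 1 < γ) (hr : 0 < r) (he : 0 < e)
    (hR : 0 < R) (hE : 0 < E) :
    r * (γ * Real.log R - Real.log E) + (γ - 1) * (r - R) + (r - R * e / E) ≤
      r * (γ * Real.log r - Real.log e) := by
  by_cases h : r ≠ R ∨ e ≠ E
  · exact (mul_log_sub_log_gt_tangent hγ hr he hR hE h).le
  · push Not at h
    obtain ⟨rfl, rfl⟩ := h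
    rw [mul_div_cancel_right₀ _ he.ne']
    linarith

/-- The concavity defect of the internal energy density. -/
lemma internalEnergy_combo {r₁ r₂ a b : ℝ} (m₁ m₂ n₁ n₂ E₁ E₂ : ℝ) (hr₁ : 0 < r₁) (hr₂ : 0 < r₂)
    (ha : 0 < a) (hb : 0 < b) :
    (a * E₁ + b * E₂) - ((a * m₁ + b * m₂) ^ 2 + (a * n₁ + b * n₂) ^ 2) / (2 * (a * r₁ + b * r₂)) =
      a * (E₁ - (m₁ ^ 2 + n₁ ^ 2) / (2 * r₁)) + b * (E₂ - (m₂ ^ 2 + n₂ ^ 2) / (2 * r₂)) +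
      a * b * ((m₁ * r₂ - m₂ * r₁) ^ 2 + (n₁ * r₂ - n₂ * r₁) ^ 2) /
        (2 * r₁ * r₂ * (a * r₁ + b * r₂)) := by
  have hR : a * r₁ + b * r₂ ≠ 0 := by positivity
  field_simp
  ring

lemma mul_log_sub_log_combo_lt {γ r₁ r₂ e₁ e₂ E a b : ℝ} (hγ : 1 < γ) (hr₁ : 0 < r₁)
    (hr₂ : 0 < r₂) (he₁ : 0 < e₁) (he₂ : 0 < e₂) (ha : 0 < a) (hb : 0 < b) (hab : a + b = 1)
    (hE : a * e₁ + b * e₂ ≤ E) (hne : r₁ ≠ r₂ ∨ e₁ ≠ E ∨ e₂ ≠ E) :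
    (a * r₁ + b * r₂) * (γ * Real.log (a * r₁ + b * r₂) - Real.log E) <
      a * (r₁ * (γ * Real.log r₁ - Real.log e₁)) + b * (r₂ * (γ * Real.log r₂ - Real.log e₂)) := by
  have hE₀ : 0 < E := lt_of_lt_of_le (by positivity) hE
  obtain ⟨R, hR⟩ : ∃ R, R = a * r₁ + b * r₂ := ⟨_, rfl⟩
  have hR₀ : 0 < R := hR ▸ by positivity
  have hne' : (r₁ ≠ R ∨ e₁ ≠ E) ∨ (r₂ ≠ R ∨ e₂ ≠ E) := by
    by_contra! h
    obtain ⟨⟨h₁, h₂⟩, h₃, h₄⟩ := h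
    simp [h₁, h₂, h₃, h₄] at hne
  have hle : R * (γ * Real.log R - Real.log E) ≤
      a * (r₁ * (γ * Real.log R - Real.log E) + (γ - 1) * (r₁ - R) + (r₁ - R * e₁ / E)) +
      b * (r₂ * (γ * Real.log R - Real.log E) + (γ - 1) * (r₂ - R) + (r₂ - R * e₂ / E)) := by
    have hdefect : R * ((a * e₁ + b * e₂) / E) ≤ R * 1 :=
      mul_le_mul_of_nonneg_left ((div_le_one hE₀).mpr hE) hR₀.le
    obtain rfl : b = 1 - a := by linarith
    linear_combination hdefect + (γ * Real.log R - Real.log E + γ) * hR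
  rw [← hR]
  refine hle.trans_lt ?_
  rcases hne' with h | h
  · exact add_lt_add_of_lt_of_le
      (mul_lt_mul_of_pos_left (mul_log_sub_log_gt_tangent hγ hr₁ he₁ hR₀ hE₀ h) ha)
      (mul_le_mul_of_nonneg_left (mul_log_sub_log_ge_tangent hγ hr₂ he₂ hR₀ hE₀) hb.le)
  · exact add_lt_add_of_le_of_lt
      (mul_le_mul_of_nonneg_left (mul_log_sub_log_ge_tangent hγ hr₁ he₁ hR₀ hE₀) ha.le)
      (mul_lt_mul_of_pos_left (mul_log_sub_log_gt_tangent hγ hr₂ he₂ hR₀ hE₀ h) hb)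

lemma entropy_eq {γ cv r e : ℝ} (hγ : 1 < γ) (hr : 0 < r) (he : 0 < e) :
    -r * (cv * Real.log ((γ - 1) * e / r ^ γ)) =
      cv * (r * (γ * Real.log r - Real.log e)) - cv * Real.log (γ - 1) * r := by
  have hγ' : 0 < γ - 1 := sub_pos.mpr hγ
  rw [Real.log_div (by positivity) (by positivity), Real.log_mul hγ'.ne' he.ne',
    Real.log_rpow hr]
  ring

/-- the entropy function `U = −ρ c_v ln(p/ρ^γ)` is strictly convex
on the set of admissible conservative states. -/
theorem stmt_9 (γ cv : ℝ) (hγ : 1 < γ) (hcv : 0 < cv) :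
    StrictConvexOn ℝ {a : Fin 4 → ℝ | 0 < a 0 ∧ 0 < a 3 - (a 1 ^ 2 + a 2 ^ 2) / (2 * a 0)}
      (fun a : Fin 4 → ℝ =>
        -(a 0) * (cv * Real.log
          ((γ - 1) * (a 3 - (a 1 ^ 2 + a 2 ^ 2) / (2 * a 0)) / a 0 ^ γ))) := by
  constructor
  · rw [convex_iff_forall_pos]
    rintro x ⟨hx, hx'⟩ y ⟨hy, hy'⟩ a b ha hb hab
    simp only [Set.mem_ofPred_eq, Pi.add_apply, Pi.smul_apply, smul_eq_mul]
    refine ⟨by positivity, ?_⟩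
    rw [internalEnergy_combo _ _ _ _ _ _ hx hy ha hb]
    positivity
  · rintro x ⟨hx, hx'⟩ y ⟨hy, hy'⟩ hxy a b ha hb hab
    simp only [Pi.add_apply, Pi.smul_apply, smul_eq_mul]
    have hcombo := internalEnergy_combo (x 1) (y 1) (x 2) (y 2) (x 3) (y 3) hx hy ha hb
    have hdefect : 0 ≤ a * b * ((x 1 * y 0 - y 1 * x 0) ^ 2 + (x 2 * y 0 - y 2 * x 0) ^ 2) /
        (2 * x 0 * y 0 * (a * x 0 + b * y 0)) := by positivity
    obtain ⟨E, hE⟩ : ∃ E, E = (a * x 3 + b * y 3) -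
        ((a * x 1 + b * y 1) ^ 2 + (a * x 2 + b * y 2) ^ 2) / (2 * (a * x 0 + b * y 0)) := ⟨_, rfl⟩
    rw [← hE] at hcombo ⊢
    obtain ⟨e₁, he₁⟩ : ∃ e, e = x 3 - (x 1 ^ 2 + x 2 ^ 2) / (2 * x 0) := ⟨_, rfl⟩
    obtain ⟨e₂, he₂⟩ : ∃ e, e = y 3 - (y 1 ^ 2 + y 2 ^ 2) / (2 * y 0) := ⟨_, rfl⟩
    rw [← he₁] at hx' hcombo ⊢
    rw [← he₂] at hy' hcombo ⊢
    have hE₀ : 0 < E := by rw [hcombo]; positivity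
    have hne : x 0 ≠ y 0 ∨ e₁ ≠ E ∨ e₂ ≠ E := by
      by_contra! h
      obtain ⟨h₀, h₁, h₂⟩ := h
      rw [h₁, h₂, ← add_mul, hab, one_mul, left_eq_add, div_eq_zero_iff] at hcombo
      have hsq := (mul_eq_zero.mp (hcombo.resolve_right (by positivity))).resolve_left
        (by positivity)
      rw [← h₀, ← sub_mul, ← sub_mul] at hsq
      have hm : x 1 = y 1 := by
        have h : (x 1 - y 1) * x 0 = 0 := by nlinarith only [hsq, sq_nonneg ((x 2 - y 2) * x 0)]
        exact sub_eq_zero.mp ((mul_eq_zero.mp h).resolve_right hx.ne')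
      have hn : x 2 = y 2 := by
        have h : (x 2 - y 2) * x 0 = 0 := by nlinarith only [hsq, sq_nonneg ((x 1 - y 1) * x 0)]
        exact sub_eq_zero.mp ((mul_eq_zero.mp h).resolve_right hx.ne')
      have hE' : x 3 = y 3 := by
        rw [h₁] at he₁
        rw [h₂, ← h₀, ← hm, ← hn] at he₂
        linarith
      refine hxy (funext fun i => ?_)
      fin_cases i
      exacts [h₀, hm, hn, hE']
    have hlt := mul_log_sub_log_combo_lt hγ hx hy hx' hy' ha hb hab (by linarith) hne
    rw [entropy_eq hγ (by positivity) hE₀, entropy_eq hγ hx hx', entropy_eq hγ hy hy']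
    linarith [mul_lt_mul_of_pos_left hlt hcv]
end

section
/- Let I be a finite index set, let adj : I → I → Prop be a symmetric irreflexive adjacency relation, let d : I → I → ℝ satisfy d(i,j) = −d(j,i) for all i,j, let f : I → I → ℝ⁴ satisfy f(i,j) = f(j,i) for all adjacent i,j, and let w : I → ℝ⁴ and ψ : I → ℝ. Assume the entropy-stability (shuffle) condition: for all adjacent i, j, ½(w(j) − w(i)) · f(i,j) · d(i,j) − ½(ψ(j) − ψ(i)) · d(i,j) ≤ 0. Then ∑_{i ∈ I} ∑_{j adjacent to i} ( w(i) · f(i,j) − ψ(i) ) · d(i,j) ≥ 0. -/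
/-- A double sum over a finite type is non-negative if each term and its transpose have a
non-negative sum. -/
theorem sum_sum_nonneg_of_add_swap_nonneg {I : Type*} [Fintype I] (T : I → I → ℝ)
    (hT : ∀ i j, 0 ≤ T i j + T j i) : 0 ≤ ∑ i, ∑ j, T i j := by
  have hsum : 0 ≤ ∑ i, ∑ j, (T i j + T j i) :=
    Finset.sum_nonneg fun i _ => Finset.sum_nonneg fun j _ => hT i j
  simp only [Finset.sum_add_distrib] at hsum
  rw [Finset.sum_comm (f := fun i j => T j i)] at hsum
  linarith

/-- the summation-by-parts mechanism: the entropy-stability (shuffle)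
condition on the symmetric numerical fluxes of a conservative scheme implies that the
total interior entropy production `∑_i ∑_{j ~ i} (w(i)·f(i,j) − ψ(i)) d(i,j)` is
non-negative. -/
theorem stmt_11 {I : Type*} [Fintype I] [DecidableEq I]
    (adj : I → I → Prop) [DecidableRel adj]
    (hsymm : ∀ i j, adj i j → adj j i) (hirrefl : ∀ i, ¬ adj i i)
    (d : I → I → ℝ) (hd : ∀ i j, d i j = -d j i)
    (f : I → I → Fin 4 → ℝ) (hf : ∀ i j, adj i j → f i j = f j i)
    (w : I → Fin 4 → ℝ) (ψ : I → ℝ)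
    (hshuffle : ∀ i j, adj i j →
      (∑ k, (w j k - w i k) / 2 * f i j k) * d i j - (ψ j - ψ i) / 2 * d i j ≤ 0) :
    0 ≤ ∑ i, ∑ j ∈ Finset.univ.filter (fun j => adj i j),
          ((∑ k, w i k * f i j k) - ψ i) * d i j := by
  simp only [Finset.sum_filter]
  refine sum_sum_nonneg_of_add_swap_nonneg _ fun i j => ?_
  by_cases h : adj i j
  · have hs := hshuffle i j h
    rw [if_pos h, if_pos (hsymm i j h), ← hf i j h, hd j i]
    simp only [Fin.sum_univ_four] at hs ⊢
    linarith
  · rw [if_neg h, if_neg fun h' => h (hsymm j i h'), add_zero]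
end

section
/- Let I be a finite index set, adj : I → I → Prop a symmetric irreflexive adjacency relation, d : I → I → ℝ with d(i,j) = −d(j,i) for all i,j, and f : I → I → ℝ with f(i,j) = f(j,i) for all adjacent i,j. Let B ⊆ I be a set of boundary nodes carrying boundary coefficients dB : I → ℝ and boundary fluxes b : I → ℝ (with dB(i) = 0 and b(i) = 0 for i ∉ B). Suppose differentiable functions ρ_i : ℝ → ℝ and positive volumes V_i satisfy the finite-volume scheme V_i ρ_i'(t) + ∑_{j adjacent to i} f(i,j) d(i,j) + b(i) dB(i) = 0 for every i ∈ I. Then the global balance holds: d/dt ∑_{i ∈ I} V_i ρ_i(t) = − ∑_{i ∈ B} b(i) dB(i); in particular all interior flux contributions cancel. -/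
/-- A symmetric flux weighted by antisymmetric differences sums to zero over all ordered pairs of
adjacent nodes. -/
theorem sum_sum_adj_mul_eq_zero {I : Type*} [Fintype I]
    (adj : I → I → Prop) [DecidableRel adj] (hsymm : ∀ i j, adj i j → adj j i)
    (d : I → I → ℝ) (hd : ∀ i j, d i j = -d j i)
    (f : I → I → ℝ) (hf : ∀ i j, adj i j → f i j = f j i) :
    ∑ i, ∑ j ∈ Finset.univ.filter (fun j => adj i j), f i j * d i j = 0 := by
  simp only [Finset.sum_filter]
  refine self_eq_neg.mp ?_
  conv_lhs => rw [Finset.sum_comm]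
  simp only [← Finset.sum_neg_distrib]
  refine Finset.sum_congr rfl fun i _ => Finset.sum_congr rfl fun j _ => ?_
  by_cases h : adj i j
  · rw [if_pos h, if_pos (hsymm i j h), hf i j h, hd i j]
    ring
  · rw [if_neg h, if_neg fun h' => h (hsymm j i h'), neg_zero]

/-- global discrete balance of a conservative node-centred finite-volume
scheme: all interior flux contributions cancel and the time derivative of the total
discrete quantity equals minus the sum of the boundary flux contributions. -/
theorem stmt_12 {I : Type*} [Fintype I] [DecidableEq I]
    (adj : I → I → Prop) [DecidableRel adj]
    (hsymm : ∀ i j, adj i j → adj j i) (hirrefl : ∀ i, ¬ adj i i)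
    (d : I → I → ℝ) (hd : ∀ i j, d i j = -d j i)
    (f : I → I → ℝ) (hf : ∀ i j, adj i j → f i j = f j i)
    (B : Finset I) (dB b : I → ℝ)
    (hdB : ∀ i ∉ B, dB i = 0) (hb : ∀ i ∉ B, b i = 0)
    (V : I → ℝ) (hV : ∀ i, 0 < V i)
    (ρ : I → ℝ → ℝ) (hρ : ∀ i, Differentiable ℝ (ρ i))
    (hscheme : ∀ i t, V i * deriv (ρ i) t
      + (∑ j ∈ Finset.univ.filter (fun j => adj i j), f i j * d i j) + b i * dB i = 0) :
    ∀ t : ℝ, HasDerivAt (fun s => ∑ i, V i * ρ i s) (-∑ i ∈ B, b i * dB i) t := by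
  intro t
  have hderiv : HasDerivAt (fun s => ∑ i, V i * ρ i s) (∑ i, V i * deriv (ρ i) t) t :=
    HasDerivAt.fun_sum fun i _ => (hρ i t).hasDerivAt.const_mul (V i)
  have hboundary : ∑ i ∈ B, b i * dB i = ∑ i, b i * dB i :=
    Finset.sum_subset (Finset.subset_univ B) fun i _ hi => by rw [hb i hi, zero_mul]
  have htotal := Finset.sum_eq_zero fun i (_ : i ∈ Finset.univ) => hscheme i t
  rw [Finset.sum_add_distrib, Finset.sum_add_distrib,
    sum_sum_adj_mul_eq_zero adj hsymm d hd f hf, add_zero] at htotal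
  rwa [hboundary, ← eq_neg_of_add_eq_zero_left htotal]
end
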